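/- arXiv:2511.00394 — 4 statements merged into one kernel-verified Lean document; each statement's English description precedes it below -/
import Mathlib

section
/- Let q = p^n with p prime, where one of the following holds: (i) p = 2 and n is prime; (ii) p = 3 and n is an odd prime; (iii) n = 1 and q is a prime with q ≡ ±3 (mod 8) and q > 17; (iv) q ∈ {7, 17}; (v) n = 1 and q is a prime with q ≡ ±1 (mod 8) such that q − 1 or q + 1 is a power of 2. Let G = PSL(2, F_q). Then there exist pronormal subgroups H and K of G such that the intersection H ∩ K is not pronormal in G. That is, the family of pronormal subgroups of G is not closed under meets. -/
/-- The conjugate `H^g := g⁻¹ H g` of a subgroup `H` by an element `g`. -/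
def Subgroup.conjugate {G : Type*} [Group G] (H : Subgroup G) (g : G) : Subgroup G :=
  H.map (MulAut.conj g⁻¹).toMonoidHom

/-- A subgroup `H` of a group `G` is pronormal in `G` if for every `g ∈ G` there exists
`x ∈ ⟨H, H^g⟩` such that `H^x = H^g`. -/
def IsPronormal {G : Type*} [Group G] (H : Subgroup G) : Prop :=
  ∀ g : G, ∃ x ∈ (H ⊔ H.conjugate g : Subgroup G), H.conjugate x = H.conjugate g

lemma sylow_mem_coe {G : Type*} [Group G] {p : ℕ} {S : Sylow p G} {x : G} :
    x ∈ (S : Subgroup G) ↔ x ∈ S := Iff.rfl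

lemma mem_conjugate_iff {G : Type*} [Group G] (H : Subgroup G) (g x : G) :
    x ∈ H.conjugate g ↔ g * x * g⁻¹ ∈ H := by
  unfold Subgroup.conjugate
  rw [Subgroup.mem_map]
  constructor
  · rintro ⟨y, hy, rfl⟩
    simpa [mul_assoc] using hy
  · intro h
    exact ⟨_, h, by simp [mul_assoc]⟩

lemma isPronormal_of_isCoatom {G : Type*} [Group G] (H : Subgroup G) (hH : IsCoatom H) :
    IsPronormal H := by
  intro g
  by_cases h : H.conjugate g ≤ H
  · rcases hH.le_iff.mp (le_refl H) with h0 | _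
    · exact absurd h0 hH.1
    have hc : ∀ K : Subgroup G, H ≤ K → K = ⊤ ∨ K = H := fun K hK => hH.le_iff.mp hK
    refine ⟨1, one_mem _, ?_⟩
    have h1 : H.conjugate 1 = H := by ext x; simp [mem_conjugate_iff]
    rw [h1]
    have h2 : H ≤ H.conjugate g⁻¹ := by
      intro x hx
      rw [mem_conjugate_iff]
      apply h
      rw [mem_conjugate_iff]
      simpa [mul_assoc] using hx
    rcases hc _ h2 with h3 | h3
    · exfalso
      apply hH.1
      rw [eq_top_iff]
      intro x _
      have : g * x * g⁻¹ ∈ H.conjugate g⁻¹ := by rw [h3]; trivial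
      rw [mem_conjugate_iff] at this
      simpa [mul_assoc] using this
    · refine le_antisymm ?_ h
      intro x hx
      rw [mem_conjugate_iff]
      rw [← h3, mem_conjugate_iff]
      simpa [mul_assoc] using hx
  · refine ⟨g, ?_, rfl⟩
    have : H ⊔ H.conjugate g = ⊤ := by
      apply hH.2
      rw [left_lt_sup]
      exact h
    rw [this]; trivial

lemma sylow_isPronormal {G : Type*} [Group G] [Finite G] {p : ℕ} [Fact p.Prime] (S : Sylow p G) :
    IsPronormal (S : Subgroup G) := by
  intro g
  have hS : ((g⁻¹ • S : Sylow p G) : Subgroup G) = (S : Subgroup G).conjugate g := by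
    ext x
    rw [mem_conjugate_iff, Sylow.coe_subgroup_smul, Subgroup.mem_pointwise_smul_iff_inv_smul_mem]
    simp
  rw [← hS]
  set X : Subgroup G := (S : Subgroup G) ⊔ (g⁻¹ • S : Sylow p G) with hX
  have h1 : (S : Subgroup G) ≤ X := le_sup_left
  have h2 : ((g⁻¹ • S : Sylow p G) : Subgroup G) ≤ X := le_sup_right
  obtain ⟨x, hx⟩ := MulAction.exists_smul_eq X (S.subtype h1) ((g⁻¹ • S).subtype h2)
  refine ⟨(x : G)⁻¹, inv_mem x.2, ?_⟩
  ext y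
  rw [mem_conjugate_iff]
  have key : ∀ y : X, y ∈ (x • S.subtype h1) ↔ y ∈ ((g⁻¹ • S).subtype h2) := by
    intro y; rw [hx]
  have key2 : ∀ y : X, (x : G)⁻¹ * y * (x : G)⁻¹⁻¹ ∈ (S : Subgroup G) ↔
      (y : G) ∈ ((g⁻¹ • S : Sylow p G) : Subgroup G) := by
    intro y
    have := key y
    rw [← sylow_mem_coe, ← sylow_mem_coe, Sylow.coe_subgroup_smul,
      Subgroup.mem_pointwise_smul_iff_inv_smul_mem, Sylow.coe_subtype, Sylow.coe_subtype,
      Subgroup.mem_subgroupOf, Subgroup.mem_subgroupOf] at this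
    simpa using this
  constructor
  · intro h
    have hy : y ∈ X := by
      have := X.mul_mem (X.mul_mem x.2 (h1 h)) (inv_mem x.2)
      simpa [mul_assoc] using this
    exact (key2 ⟨y, hy⟩).1 h
  · intro h
    exact (key2 ⟨y, h2 h⟩).2 h

lemma not_isPronormal {G : Type*} [Group G] (H : Subgroup G) (t g : G)
    (hH : ∀ x, x ∈ H ↔ x = 1 ∨ x = t) (ht : t ≠ 1)
    (hne : g⁻¹ * t * g ≠ t) (hc : Commute (g⁻¹ * t * g) t) : ¬ IsPronormal H := by
  intro h
  obtain ⟨x, hx, hxg⟩ := h g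
  have hle : H ⊔ H.conjugate g ≤ Subgroup.centralizer {t} := by
    refine sup_le ?_ ?_
    · intro y hy
      rw [Subgroup.mem_centralizer_singleton_iff]
      rcases (hH y).1 hy with rfl | rfl <;> simp
    · intro y hy
      rw [mem_conjugate_iff, hH] at hy
      rw [Subgroup.mem_centralizer_singleton_iff]
      rcases hy with hy | hy
      · have : y = 1 := by
          have : y = g⁻¹ * (g * y * g⁻¹) * g := by group
          rw [this, hy]; group
        subst this; simp
      · have : y = g⁻¹ * t * g := by
          rw [← hy]; group
        subst this
        exact hc
  have hxt := Subgroup.mem_centralizer_singleton_iff.1 (hle hx)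
  have h1 : g⁻¹ * t * g ∈ H.conjugate g := by
    rw [mem_conjugate_iff, hH]; right; group
  rw [← hxg, mem_conjugate_iff, hH] at h1
  rcases h1 with h1 | h1
  · apply ht
    have : t = g * (x⁻¹ * (x * (g⁻¹ * t * g) * x⁻¹) * x) * g⁻¹ := by group
    rw [this, h1]; group
  · apply hne
    have : g⁻¹ * t * g = x⁻¹ * (x * (g⁻¹ * t * g) * x⁻¹) * x := by group
    rw [this, h1, mul_assoc, ← hxt]; group

/-- A Sylow subgroup inside the centralizer of an involution, containing a given commuting
involution. -/
lemma exists_sylow_le_centralizer {G : Type*} [Group G] [Finite G]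
    (hconj : ∀ a b : G, a ≠ 1 → a ^ 2 = 1 → b ≠ 1 → b ^ 2 = 1 → ∃ g : G, g * a * g⁻¹ = b)
    (t z : G) (ht : t ^ 2 = 1) (hz1 : z ≠ 1) (hz : z ^ 2 = 1) (hc : Commute t z) :
    ∃ S : Sylow 2 G, t ∈ S ∧ ∀ x ∈ S, Commute x z := by
  have : Fact (Nat.Prime 2) := ⟨Nat.prime_two⟩
  -- a Sylow containing `z`
  have hzp : IsPGroup 2 (Subgroup.zpowers z) := by
    apply IsPGroup.of_card (n := 1)
    rw [Nat.card_zpowers, pow_one]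
    exact orderOf_eq_prime hz hz1
  obtain ⟨S, hS⟩ := hzp.exists_le_sylow
  have hzS : z ∈ S := hS (Subgroup.mem_zpowers z)
  -- a central involution
  have : Nontrivial S := ⟨⟨⟨z, hzS⟩, 1, fun h => hz1 (congrArg Subtype.val h)⟩⟩
  have hcen := S.isPGroup'.center_nontrivial
  have hcp : IsPGroup 2 (Subgroup.center S) := S.isPGroup'.to_subgroup _
  obtain ⟨n, hn, hcard⟩ := (IsPGroup.nontrivial_iff_card hcp).1 hcen
  obtain ⟨c, hcord⟩ := exists_prime_orderOf_dvd_card' (G := Subgroup.center S) 2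
    (by rw [hcard]; exact dvd_pow_self _ hn.ne')
  have hc2 : ((c : S) : G) ^ 2 = 1 := by
    have h0 : c ^ 2 = 1 := orderOf_dvd_iff_pow_eq_one.1 hcord.dvd
    have := congrArg (fun y : Subgroup.center S => ((y : S) : G)) h0
    simpa using this
  have hc1 : ((c : S) : G) ≠ 1 := by
    intro h
    have : c = 1 := by
      apply Subtype.ext; apply Subtype.ext; simpa using h
    rw [this, orderOf_one] at hcord
    omega
  obtain ⟨g, hg⟩ := hconj _ z hc1 hc2 hz1 hz
  have hle : ((g • S : Sylow 2 G) : Subgroup G) ≤ Subgroup.centralizer {z} := by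
    intro x hx
    rw [Sylow.coe_subgroup_smul, Subgroup.mem_pointwise_smul_iff_inv_smul_mem] at hx
    have hx' : g⁻¹ * x * g ∈ (S : Subgroup G) := by simpa using hx
    have h1 := (Subgroup.mem_center_iff.1 c.2) ⟨_, hx'⟩
    have h2 : g⁻¹ * x * g * ((c : S) : G) = ((c : S) : G) * (g⁻¹ * x * g) :=
      congrArg Subtype.val h1
    rw [Subgroup.mem_centralizer_singleton_iff, ← hg]
    calc x * (g * ((c : S) : G) * g⁻¹) = g * (g⁻¹ * x * g * ((c : S) : G)) * g⁻¹ := by group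
      _ = _ := by rw [h2]; group
  set C := Subgroup.centralizer {z} with hC
  have htC : t ∈ C := Subgroup.mem_centralizer_singleton_iff.2 hc
  have htp : IsPGroup 2 (Subgroup.zpowers (⟨t, htC⟩ : C)) := by
    intro y
    refine ⟨1, ?_⟩
    obtain ⟨k, hk⟩ := Subgroup.mem_zpowers_iff.1 y.2
    have ht' : (⟨t, htC⟩ : C) ^ 2 = 1 := Subtype.ext (by simpa using ht)
    apply Subtype.ext
    rw [Subgroup.coe_pow, ← hk, pow_one, ← zpow_natCast, ← zpow_mul, mul_comm, zpow_mul,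
      zpow_natCast, ht']
    simp
  obtain ⟨Q, hQ⟩ := htp.exists_le_sylow
  obtain ⟨x, hx⟩ := MulAction.exists_smul_eq C ((g • S).subtype hle) Q
  have htQ : (⟨t, htC⟩ : C) ∈ Q := hQ (Subgroup.mem_zpowers _)
  refine ⟨(x : G) • (g • S), ?_, ?_⟩
  · rw [← hx, ← sylow_mem_coe, Sylow.coe_subgroup_smul,
      Subgroup.mem_pointwise_smul_iff_inv_smul_mem, Sylow.coe_subtype,
      Subgroup.mem_subgroupOf] at htQ
    rw [← sylow_mem_coe, Sylow.coe_subgroup_smul,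
      Subgroup.mem_pointwise_smul_iff_inv_smul_mem]
    simpa using htQ
  · intro y hy
    rw [← sylow_mem_coe, Sylow.coe_subgroup_smul,
      Subgroup.mem_pointwise_smul_iff_inv_smul_mem] at hy
    have h1 : (x : G)⁻¹ * y * x ∈ C := hle (by simpa using hy)
    have h2 : y ∈ C := by
      have := C.mul_mem (C.mul_mem x.2 h1) (inv_mem x.2)
      simpa [mul_assoc] using this
    exact Subgroup.mem_centralizer_singleton_iff.1 h2

lemma odd_abstract {G : Type*} [Group G] [Finite G]
    (hconj : ∀ a b : G, a ≠ 1 → a ^ 2 = 1 → b ≠ 1 → b ^ 2 = 1 → ∃ g : G, g * a * g⁻¹ = b)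
    (t z₁ z₂ : G) (ht1 : t ≠ 1) (ht : t ^ 2 = 1) (h11 : z₁ ≠ 1) (h1 : z₁ ^ 2 = 1)
    (h21 : z₂ ≠ 1) (h2 : z₂ ^ 2 = 1) (hc1 : Commute t z₁) (hc2 : Commute t z₂) (hne : z₁ ≠ t)
    (hcc : ∀ x : G, Commute x z₁ → Commute x z₂ → x = 1 ∨ x = t) :
    ∃ H K : Subgroup G, IsPronormal H ∧ IsPronormal K ∧ ¬ IsPronormal (H ⊓ K) := by
  have : Fact (Nat.Prime 2) := ⟨Nat.prime_two⟩
  obtain ⟨S, hS, hS'⟩ := exists_sylow_le_centralizer hconj t z₁ ht h11 h1 hc1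
  obtain ⟨T, hT, hT'⟩ := exists_sylow_le_centralizer hconj t z₂ ht h21 h2 hc2
  obtain ⟨g, hg⟩ := hconj t z₁ ht1 ht h11 h1
  refine ⟨S, T, sylow_isPronormal S, sylow_isPronormal T,
    not_isPronormal _ t g⁻¹ ?_ ht1 (by simpa [hg] using hne) (by simpa [hg] using hc1.symm)⟩
  intro x
  constructor
  · intro hx
    exact hcc x (hS' x hx.1) (hT' x hx.2)
  · rintro (rfl | rfl)
    · exact one_mem _
    · exact ⟨hS, hT⟩

open Matrix in
lemma sl2_ext {F : Type*} [Field F] (A B : SpecialLinearGroup (Fin 2) F)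
    (h1 : A.1 0 0 = B.1 0 0) (h2 : A.1 0 1 = B.1 0 1) (h3 : A.1 1 0 = B.1 1 0)
    (h4 : A.1 1 1 = B.1 1 1) : A = B := by
  apply Subtype.ext
  ext i j
  fin_cases i <;> fin_cases j <;> assumption

open Matrix in
lemma sl2_det {F : Type*} [Field F] (A : SpecialLinearGroup (Fin 2) F) :
    A.1 0 0 * A.1 1 1 - A.1 0 1 * A.1 1 0 = 1 := by
  rw [← Matrix.det_fin_two]; exact A.2

/-- The element of `SL₂` with the given entries. -/
def mkSL {F : Type*} [Field F] (a b c d : F) (h : a * d - b * c = 1) :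
    Matrix.SpecialLinearGroup (Fin 2) F :=
  ⟨!![a, b; c, d], by rw [Matrix.det_fin_two_of]; exact h⟩

lemma eq_mkSL {F : Type*} [Field F] (A : Matrix.SpecialLinearGroup (Fin 2) F) :
    ∃ (a b c d : F) (h : a * d - b * c = 1), A = mkSL a b c d h := by
  refine ⟨_, _, _, _, sl2_det A, ?_⟩
  apply sl2_ext <;> simp [mkSL]

lemma mkSL_mul {F : Type*} [Field F] (a b c d a' b' c' d' : F) (h : a * d - b * c = 1)
    (h' : a' * d' - b' * c' = 1) :
    mkSL a b c d h * mkSL a' b' c' d' h' =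
      mkSL (a * a' + b * c') (a * b' + b * d') (c * a' + d * c') (c * b' + d * d')
        (by linear_combination (a' * d' - b' * c') * h + h') := by
  apply Subtype.ext
  exact (Matrix.mul_fin_two a b c d a' b' c' d').trans rfl

lemma mkSL_inj {F : Type*} [Field F] {a b c d a' b' c' d' : F} {h : a * d - b * c = 1}
    {h' : a' * d' - b' * c' = 1} :
    mkSL a b c d h = mkSL a' b' c' d' h' ↔ a = a' ∧ b = b' ∧ c = c' ∧ d = d' := by
  constructor
  · intro e
    have e' := congrArg Subtype.val e
    simp only [mkSL] at e'
    refine ⟨?_, ?_, ?_, ?_⟩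
    · simpa using congrFun (congrFun e' 0) 0
    · simpa using congrFun (congrFun e' 0) 1
    · simpa using congrFun (congrFun e' 1) 0
    · simpa using congrFun (congrFun e' 1) 1
  · rintro ⟨rfl, rfl, rfl, rfl⟩; rfl

lemma mkSL_neg {F : Type*} [Field F] {a b c d : F} {h : a * d - b * c = 1} :
    - mkSL a b c d h = mkSL (-a) (-b) (-c) (-d) (by linear_combination h) := by
  apply sl2_ext <;> rw [Matrix.SpecialLinearGroup.coe_neg] <;> simp [mkSL]

lemma mkSL_one {F : Type*} [Field F] :
    (1 : Matrix.SpecialLinearGroup (Fin 2) F) = mkSL 1 0 0 1 (by simp) := by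
  apply sl2_ext <;> simp [mkSL]

lemma mkSL_inv {F : Type*} [Field F] {a b c d : F} {h : a * d - b * c = 1} :
    (mkSL a b c d h)⁻¹ = mkSL d (-b) (-c) a (by linear_combination h) := by
  rw [inv_eq_iff_mul_eq_one, mkSL_mul, mkSL_one, mkSL_inj]
  refine ⟨?_, ?_, ?_, ?_⟩
  · linear_combination h
  · ring
  · ring
  · linear_combination h

lemma mem_center_sl2 {F : Type*} [Field F] (A : Matrix.SpecialLinearGroup (Fin 2) F) :
    A ∈ Subgroup.center (Matrix.SpecialLinearGroup (Fin 2) F) ↔ A = 1 ∨ A = -1 := by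
  constructor
  · intro h
    obtain ⟨r, hr, hA⟩ := Matrix.SpecialLinearGroup.mem_center_iff.1 h
    rw [Fintype.card_fin, sq_eq_one_iff] at hr
    rcases hr with rfl | rfl
    · left; apply Subtype.ext; rw [← hA]; simp
    · right; apply Subtype.ext; rw [← hA]; ext i j; fin_cases i <;> fin_cases j <;> simp
  · rintro (rfl | rfl)
    · exact one_mem _
    · rw [Subgroup.mem_center_iff]; intro g; simp

lemma psl_eq_iff {F : Type*} [Field F] (A B : Matrix.SpecialLinearGroup (Fin 2) F) :
    (A : Matrix.ProjectiveSpecialLinearGroup (Fin 2) F) = B ↔ B = A ∨ B = -A := by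
  rw [QuotientGroup.eq, mem_center_sl2, inv_mul_eq_iff_eq_mul, inv_mul_eq_iff_eq_mul]
  simp

/-- Involutions of `PSL₂` in odd characteristic come from traceless matrices. -/
lemma involution_form {F : Type*} [Field F] (h2 : (2 : F) ≠ 0)
    (x : Matrix.ProjectiveSpecialLinearGroup (Fin 2) F) (hx1 : x ≠ 1) (hx : x ^ 2 = 1) :
    ∃ (a b c : F) (h : a * (-a) - b * c = 1), x = mkSL a b c (-a) h := by
  obtain ⟨A, rfl⟩ := QuotientGroup.mk_surjective x
  obtain ⟨a, b, c, d, h, rfl⟩ := eq_mkSL A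
  have hx1' : ¬ ((mkSL a b c d h : Matrix.ProjectiveSpecialLinearGroup (Fin 2) F) =
    ((1 : Matrix.SpecialLinearGroup (Fin 2) F) :)) := hx1
  have hx' : (((mkSL a b c d h) * (mkSL a b c d h) : Matrix.SpecialLinearGroup (Fin 2) F) :
    Matrix.ProjectiveSpecialLinearGroup (Fin 2) F) =
    ((1 : Matrix.SpecialLinearGroup (Fin 2) F) :) := by
    rw [← sq]; exact hx
  rw [psl_eq_iff, mkSL_mul, mkSL_neg, mkSL_one, mkSL_inj, mkSL_inj] at hx'
  rw [psl_eq_iff, mkSL_neg, mkSL_one, mkSL_inj, mkSL_inj] at hx1'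
  by_cases had : a + d = 0
  · obtain rfl : d = -a := by linear_combination had
    exact ⟨a, b, c, h, rfl⟩
  · exfalso
    have hb : b = 0 := by
      rcases hx' with ⟨_, h1, _, _⟩ | ⟨_, h1, _, _⟩
      · exact (mul_eq_zero.1 (show b * (a + d) = 0 by linear_combination -h1)).resolve_right had
      · exact (mul_eq_zero.1 (show b * (a + d) = 0 by linear_combination h1)).resolve_right had
    have hc : c = 0 := by
      rcases hx' with ⟨_, _, h1, _⟩ | ⟨_, _, h1, _⟩
      · exact (mul_eq_zero.1 (show c * (a + d) = 0 by linear_combination -h1)).resolve_right had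
      · exact (mul_eq_zero.1 (show c * (a + d) = 0 by linear_combination h1)).resolve_right had
    subst hb hc
    have ha0 : a ≠ 0 := by rintro rfl; simp at h
    rcases hx' with ⟨h1, _, _, h4⟩ | ⟨h1, _, _, h4⟩
    · have hda : d = a := by
        apply mul_left_cancel₀ ha0; linear_combination h + h1
      subst hda
      have : (d - 1) * (d + 1) = 0 := by linear_combination h
      rcases mul_eq_zero.1 this with h5 | h5
      · apply hx1'; left; refine ⟨?_, rfl, rfl, ?_⟩ <;> linear_combination -h5
      · apply hx1'; right; refine ⟨?_, by simp, by simp, ?_⟩ <;> linear_combination h5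
    · apply had
      apply mul_left_cancel₀ ha0; linear_combination h + h1

lemma exists_conj_J {F : Type*} [Field F] [Fintype F] (h2 : (2 : F) ≠ 0)
    (hodd : Fintype.card F % 2 = 1) (a b c : F) (h : a * (-a) - b * c = 1) :
    ∃ P : Matrix.SpecialLinearGroup (Fin 2) F,
      P * mkSL 0 (-1) 1 0 (by simp) = mkSL a b c (-a) h * P := by
  have key : ∃ x y : F, c * x ^ 2 - 2 * a * x * y - b * y ^ 2 = 1 := by
    by_cases hc : c = 0
    · subst hc
      have ha : a ≠ 0 := by rintro rfl; simp at h
      refine ⟨(1 + b) / (-2 * a), 1, ?_⟩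
      field_simp
      ring
    · obtain ⟨X, y, hXy⟩ := FiniteField.exists_root_sum_quadratic
        (f := Polynomial.C c * Polynomial.X ^ 2 + Polynomial.C 0 * Polynomial.X + Polynomial.C (-1))
        (g := Polynomial.C c⁻¹ * Polynomial.X ^ 2 + Polynomial.C 0 * Polynomial.X +
          Polynomial.C 0)
        (Polynomial.degree_quadratic hc) (Polynomial.degree_quadratic (inv_ne_zero hc)) hodd
      refine ⟨X + a * y / c, y, ?_⟩
      simp only [Polynomial.eval_add, Polynomial.eval_mul, Polynomial.eval_C, Polynomial.eval_pow,
        Polynomial.eval_X] at hXy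
      field_simp at hXy ⊢
      linear_combination hXy + y ^ 2 * h
  obtain ⟨x, y, hxy⟩ := key
  refine ⟨mkSL x (a * x + b * y) y (c * x - a * y) (by linear_combination hxy), ?_⟩
  rw [mkSL_mul, mkSL_mul, mkSL_inj]
  refine ⟨by ring, ?_, by ring, ?_⟩
  · linear_combination x * h
  · linear_combination y * h

lemma psl_involutions_conj {F : Type*} [Field F] [Fintype F] (h2 : (2 : F) ≠ 0)
    (hodd : Fintype.card F % 2 = 1)
    (x y : Matrix.ProjectiveSpecialLinearGroup (Fin 2) F) (hx1 : x ≠ 1) (hx : x ^ 2 = 1)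
    (hy1 : y ≠ 1) (hy : y ^ 2 = 1) : ∃ g, g * x * g⁻¹ = y := by
  obtain ⟨a, b, c, h, rfl⟩ := involution_form h2 x hx1 hx
  obtain ⟨a', b', c', h', rfl⟩ := involution_form h2 y hy1 hy
  obtain ⟨P, hP⟩ := exists_conj_J h2 hodd a b c h
  obtain ⟨Q, hQ⟩ := exists_conj_J h2 hodd a' b' c' h'
  refine ⟨((Q * P⁻¹ : Matrix.SpecialLinearGroup (Fin 2) F) :), ?_⟩
  have : (Q * P⁻¹) * mkSL a b c (-a) h * (Q * P⁻¹)⁻¹ = mkSL a' b' c' (-a') h' := by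
    have e1 : mkSL a b c (-a) h = P * mkSL 0 (-1) 1 0 (by simp) * P⁻¹ := by rw [hP]; group
    have e2 : mkSL a' b' c' (-a') h' = Q * mkSL 0 (-1) 1 0 (by simp) * Q⁻¹ := by rw [hQ]; group
    rw [e1, e2]; group
  rw [← this]; rfl

lemma exists_param {F : Type*} [Field F] [Fintype F] (h2 : (2 : F) ≠ 0)
    (hcard : 5 < Fintype.card F) : ∃ c s : F, c ≠ 0 ∧ s ≠ 0 ∧ c ^ 2 + s ^ 2 = 1 := by
  classical
  have : ∃ m : F, m ^ 5 - m ≠ 0 := by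
    by_contra! hcon
    have hd : (Polynomial.X ^ 5 - Polynomial.X : Polynomial F).degree = 5 := by
      compute_degree!
    have hne : (Polynomial.X ^ 5 - Polynomial.X : Polynomial F) ≠ 0 := by
      intro h0; rw [h0] at hd; simp at hd
    have := Polynomial.card_le_degree_of_subset_roots (p := (Polynomial.X ^ 5 - Polynomial.X :
      Polynomial F)) (Z := Finset.univ) (by
        intro m _
        rw [Polynomial.mem_roots hne]
        simpa using hcon m)
    rw [Polynomial.natDegree_eq_of_degree_eq_some (n := 5) hd, Finset.card_univ] at this
    omega
  obtain ⟨m, hm⟩ := this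
  have h1 : m ≠ 0 := by rintro rfl; simp at hm
  have h3 : 1 + m ^ 2 ≠ 0 := by
    intro h0; apply hm; linear_combination (m ^ 3 - m) * h0
  have h4 : 1 - m ^ 2 ≠ 0 := by
    intro h0; apply hm; linear_combination (-m ^ 3 - m) * h0
  refine ⟨(1 - m ^ 2) / (1 + m ^ 2), 2 * m / (1 + m ^ 2), div_ne_zero h4 h3,
    div_ne_zero (mul_ne_zero h2 h1) h3, ?_⟩
  field_simp
  ring

lemma sl2_anticomm_trace {F : Type*} [Field F] (h2 : (2 : F) ≠ 0)
    (M : Matrix.SpecialLinearGroup (Fin 2) F) (a b c d : F) (h : a * d - b * c = 1)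
    (hM : M * mkSL a b c d h = -(mkSL a b c d h * M)) : a + d = 0 := by
  set Y := mkSL a b c d h with hY
  have e : M * Y * M⁻¹ = -Y := by rw [hM]; simp
  have e' := congrArg (fun B : Matrix.SpecialLinearGroup (Fin 2) F => Matrix.trace B.1) e
  simp only [Matrix.SpecialLinearGroup.coe_mul, Matrix.SpecialLinearGroup.coe_neg,
    Matrix.trace_neg] at e'
  rw [Matrix.trace_mul_comm, ← mul_assoc, ← Matrix.SpecialLinearGroup.coe_mul, inv_mul_cancel,
    Matrix.SpecialLinearGroup.coe_one, one_mul] at e'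
  have ht : Matrix.trace Y.1 = a + d := by simp [hY, mkSL, Matrix.trace_fin_two]
  rw [ht] at e'
  apply (mul_eq_zero.1 (show 2 * (a + d) = 0 by linear_combination e')).resolve_left h2

lemma sl2_centralizer {F : Type*} [Field F] (h2 : (2 : F) ≠ 0)
    (M : Matrix.SpecialLinearGroup (Fin 2) F) (a b a' b' : F)
    (h : a * (-a) - b * b = 1) (h' : a' * (-a') - b' * b' = 1) (hcr : a * b' - b * a' ≠ 0)
    (hM : M * mkSL a b b (-a) h = mkSL a b b (-a) h * M)
    (hM' : M * mkSL a' b' b' (-a') h' = mkSL a' b' b' (-a') h' * M) : M = 1 ∨ M = -1 := by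
  obtain ⟨x, y, z, w, hA, rfl⟩ := eq_mkSL M
  rw [mkSL_mul, mkSL_mul, mkSL_inj] at hM hM'
  obtain ⟨e1, e2, e3, e4⟩ := hM
  obtain ⟨f1, f2, f3, f4⟩ := hM'
  have hzy : z = y := by
    apply mul_left_cancel₀ hcr
    linear_combination a' * e1 - a * f1
  subst hzy
  have hz : z = 0 := by
    have : 2 * (a * b' - b * a') * z = 0 := by linear_combination b * f2 - b' * e2
    exact (mul_eq_zero.1 this).resolve_left (mul_ne_zero h2 hcr)
  have hw : w = x := by
    apply mul_left_cancel₀ hcr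
    linear_combination a' * e2 - a * f2
  subst hw hz
  rw [mkSL_one, mkSL_neg, mkSL_inj, mkSL_inj]
  have : (w - 1) * (w + 1) = 0 := by linear_combination hA
  rcases mul_eq_zero.1 this with h5 | h5
  · left; refine ⟨?_, rfl, rfl, ?_⟩ <;> linear_combination h5
  · right; refine ⟨?_, by simp, by simp, ?_⟩ <;> linear_combination h5

lemma odd_case {F : Type*} [Field F] [Fintype F] (h2 : (2 : F) ≠ 0)
    (hodd : Fintype.card F % 2 = 1) (hcard : 5 < Fintype.card F) :
    ∃ H K : Subgroup (Matrix.ProjectiveSpecialLinearGroup (Fin 2) F),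
      IsPronormal H ∧ IsPronormal K ∧ ¬ IsPronormal (H ⊓ K) := by
  have hab : ∃ a b : F, a ^ 2 + b ^ 2 = -1 := by
    obtain ⟨X, y, hXy⟩ := FiniteField.exists_root_sum_quadratic
        (f := Polynomial.C (1 : F) * Polynomial.X ^ 2 + Polynomial.C 0 * Polynomial.X +
          Polynomial.C 1)
        (g := Polynomial.C (1 : F) * Polynomial.X ^ 2 + Polynomial.C 0 * Polynomial.X +
          Polynomial.C 0)
        (Polynomial.degree_quadratic one_ne_zero) (Polynomial.degree_quadratic one_ne_zero) hodd
    refine ⟨X, y, ?_⟩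
    simp only [Polynomial.eval_add, Polynomial.eval_mul, Polynomial.eval_C, Polynomial.eval_pow,
        Polynomial.eval_X] at hXy
    linear_combination hXy
  obtain ⟨a, b, hab⟩ := hab
  obtain ⟨c, s, hc, hs, hcs⟩ := exists_param h2 hcard
  obtain ⟨a', ha'⟩ : ∃ a', a' = c * a - s * b := ⟨_, rfl⟩
  obtain ⟨b', hb'⟩ : ∃ b', b' = s * a + c * b := ⟨_, rfl⟩
  have hab' : a' ^ 2 + b' ^ 2 = -1 := by
    subst ha' hb'; linear_combination (c ^ 2 + s ^ 2) * hab - hcs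
  have hin : a * a' + b * b' = -c := by
    subst ha' hb'; linear_combination c * hab
  have hcr : a * b' - b * a' = -s := by
    subst ha' hb'; linear_combination s * hab
  have hd1 : a * (-a) - b * b = 1 := by linear_combination -hab
  have hd2 : a' * (-a') - b' * b' = 1 := by linear_combination -hab'
  have h11 : (1 : F) ≠ -1 := by
    intro h; apply h2; linear_combination h
  have cast_sq : ∀ A : Matrix.SpecialLinearGroup (Fin 2) F,
      (A : Matrix.ProjectiveSpecialLinearGroup (Fin 2) F) ^ 2 =
      ((A * A : Matrix.SpecialLinearGroup (Fin 2) F) :) := by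
    intro A; rw [sq]; rfl
  have cast_one : (1 : Matrix.ProjectiveSpecialLinearGroup (Fin 2) F) =
      ((1 : Matrix.SpecialLinearGroup (Fin 2) F) :) := rfl
  have cast_comm : ∀ A B : Matrix.SpecialLinearGroup (Fin 2) F,
      Commute (A : Matrix.ProjectiveSpecialLinearGroup (Fin 2) F) B ↔
      (B * A = A * B ∨ B * A = - (A * B)) := by
    intro A B
    rw [← psl_eq_iff]; rfl
  refine odd_abstract (psl_involutions_conj h2 hodd)
    (mkSL 0 1 (-1) 0 (by simp) : Matrix.SpecialLinearGroup (Fin 2) F)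
    (mkSL a b b (-a) hd1 : Matrix.SpecialLinearGroup (Fin 2) F)
    (mkSL a' b' b' (-a') hd2 : Matrix.SpecialLinearGroup (Fin 2) F)
    ?_ ?_ ?_ ?_ ?_ ?_ ?_ ?_ ?_ ?_
  · rw [cast_one, Ne, psl_eq_iff, mkSL_neg, mkSL_one, mkSL_inj, mkSL_inj]
    simp
  · rw [cast_sq, cast_one, psl_eq_iff, mkSL_mul, mkSL_neg, mkSL_one, mkSL_inj, mkSL_inj]
    simp
  · rw [cast_one, Ne, psl_eq_iff, mkSL_neg, mkSL_one, mkSL_inj, mkSL_inj]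
    rintro (⟨h1, h3, h4, h5⟩ | ⟨h1, h3, h4, h5⟩)
    · apply h2; linear_combination h1 + h5
    · apply h2; linear_combination h1 + h5
  · rw [cast_sq, cast_one, psl_eq_iff, mkSL_mul, mkSL_neg, mkSL_one, mkSL_inj, mkSL_inj]
    right
    refine ⟨?_, ?_, ?_, ?_⟩
    · linear_combination hab
    · ring
    · ring
    · linear_combination hab
  · rw [cast_one, Ne, psl_eq_iff, mkSL_neg, mkSL_one, mkSL_inj, mkSL_inj]
    rintro (⟨h1, h3, h4, h5⟩ | ⟨h1, h3, h4, h5⟩)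
    · apply h2; linear_combination h1 + h5
    · apply h2; linear_combination h1 + h5
  · rw [cast_sq, cast_one, psl_eq_iff, mkSL_mul, mkSL_neg, mkSL_one, mkSL_inj, mkSL_inj]
    right
    refine ⟨?_, ?_, ?_, ?_⟩
    · linear_combination hab'
    · ring
    · ring
    · linear_combination hab'
  · rw [cast_comm, mkSL_mul, mkSL_mul, mkSL_neg, mkSL_inj, mkSL_inj]
    right; refine ⟨?_, ?_, ?_, ?_⟩ <;> ring
  · rw [cast_comm, mkSL_mul, mkSL_mul, mkSL_neg, mkSL_inj, mkSL_inj]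
    right; refine ⟨?_, ?_, ?_, ?_⟩ <;> ring
  · rw [Ne, psl_eq_iff, mkSL_neg, mkSL_inj, mkSL_inj]
    rintro (⟨h1, h3, h4, h5⟩ | ⟨h1, h3, h4, h5⟩)
    · apply h2; linear_combination h3 - h4
    · apply h2; linear_combination h3 - h4
  · intro x hx1 hx2
    obtain ⟨A, rfl⟩ := QuotientGroup.mk_surjective x
    rw [cast_comm] at hx1 hx2
    rw [cast_one, psl_eq_iff, psl_eq_iff]
    generalize hT : (mkSL 0 1 (-1) 0 (by simp) : Matrix.SpecialLinearGroup (Fin 2) F) = T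
    have t1 : T * mkSL a b b (-a) hd1 = -(mkSL a b b (-a) hd1 * T) := by
      rw [← hT, mkSL_mul, mkSL_mul, mkSL_neg, mkSL_inj]
      refine ⟨?_, ?_, ?_, ?_⟩ <;> ring
    have t2 : T * mkSL a' b' b' (-a') hd2 = -(mkSL a' b' b' (-a') hd2 * T) := by
      rw [← hT, mkSL_mul, mkSL_mul, mkSL_neg, mkSL_inj]
      refine ⟨?_, ?_, ?_, ?_⟩ <;> ring
    have hTT : T * T = -1 := by
      rw [← hT, mkSL_mul, mkSL_one, mkSL_neg, mkSL_inj]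
      refine ⟨?_, ?_, ?_, ?_⟩ <;> ring
    have hmix : A * (mkSL a b b (-a) hd1 * mkSL a' b' b' (-a') hd2) ≠
        -((mkSL a b b (-a) hd1 * mkSL a' b' b' (-a') hd2) * A) := by
      rw [mkSL_mul]
      intro hh
      have := sl2_anticomm_trace h2 _ _ _ _ _ _ hh
      have h3 : 2 * c = 0 := by linear_combination -this + 2 * hin
      rcases mul_eq_zero.1 h3 with h4 | h4
      · exact h2 h4
      · exact hc h4
    have hcent := fun M => sl2_centralizer h2 M a b a' b' hd1 hd2 (by rw [hcr]; simpa using hs)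
    generalize mkSL a b b (-a) hd1 = Z at *
    generalize mkSL a' b' b' (-a') hd2 = Z' at *
    rcases hx1 with hx1 | hx1 <;> rcases hx2 with hx2 | hx2
    · left
      rcases hcent A hx1.symm hx2.symm with rfl | rfl
      · left; rfl
      · right; simp
    · exfalso
      apply hmix
      rw [← mul_assoc, ← hx1, mul_assoc Z A Z', ← neg_eq_iff_eq_neg.2 hx2]
      simp [mul_assoc]
    · exfalso
      apply hmix
      rw [mul_assoc Z Z' A, hx2, ← mul_assoc Z A Z', hx1]
      simp [mul_assoc]
    · right
      have g1 : (T * A) * Z = Z * (T * A) := by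
        rw [← mul_assoc Z, ← neg_eq_iff_eq_neg.2 t1, mul_assoc, ← neg_eq_iff_eq_neg.2 hx1]
        simp [mul_assoc]
      have g2 : (T * A) * Z' = Z' * (T * A) := by
        rw [← mul_assoc Z', ← neg_eq_iff_eq_neg.2 t2, mul_assoc, ← neg_eq_iff_eq_neg.2 hx2]
        simp [mul_assoc]
      rcases hcent _ g1 g2 with h5 | h5
      · right
        have := congrArg (fun B => -(T * B)) h5
        simp only [← mul_assoc, hTT] at this
        have h6 : A = -T := by simpa using this
        rw [h6]; simp
      · left
        have := congrArg (fun B => -(T * B)) h5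
        simp only [← mul_assoc, hTT] at this
        have h6 : A = T := by simpa using this
        rw [h6]

lemma conjugate_map {G G' : Type*} [Group G] [Group G'] (e : G ≃* G') (H : Subgroup G) (g : G) :
    (H.map e.toMonoidHom).conjugate (e g) = (H.conjugate g).map e.toMonoidHom := by
  ext x
  obtain ⟨y, rfl⟩ := e.surjective x
  rw [mem_conjugate_iff, ← map_mul, ← map_inv, ← map_mul]
  change e.toMonoidHom _ ∈ _ ↔ e.toMonoidHom y ∈ _
  rw [Subgroup.mem_map_iff_mem e.injective, Subgroup.mem_map_iff_mem e.injective,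
    mem_conjugate_iff]

lemma isPronormal_map_iff {G G' : Type*} [Group G] [Group G'] (e : G ≃* G') (H : Subgroup G) :
    IsPronormal (H.map e.toMonoidHom) ↔ IsPronormal H := by
  unfold IsPronormal
  rw [e.surjective.forall]
  refine forall_congr' fun g => ?_
  rw [e.surjective.exists]
  refine exists_congr fun x => ?_
  rw [conjugate_map, conjugate_map, ← Subgroup.map_sup,
    (Subgroup.map_injective e.injective).eq_iff]
  change e.toMonoidHom x ∈ _ ∧ _ ↔ _
  rw [Subgroup.mem_map_iff_mem e.injective]

lemma transport {G G' : Type*} [Group G] [Group G'] (e : G ≃* G')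
    (h : ∃ H K : Subgroup G, IsPronormal H ∧ IsPronormal K ∧ ¬ IsPronormal (H ⊓ K)) :
    ∃ H K : Subgroup G', IsPronormal H ∧ IsPronormal K ∧ ¬ IsPronormal (H ⊓ K) := by
  obtain ⟨H, K, h1, h2, h3⟩ := h
  refine ⟨H.map e.toMonoidHom, K.map e.toMonoidHom, (isPronormal_map_iff e H).2 h1,
    (isPronormal_map_iff e K).2 h2, ?_⟩
  rw [← Subgroup.map_inf _ _ _ e.injective, isPronormal_map_iff]
  exact h3

/-- The monomial subgroup of `SL₂`. -/
def monoSub (F : Type*) [Field F] : Subgroup (Matrix.SpecialLinearGroup (Fin 2) F) where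
  carrier := {A | (A.1 0 1 = 0 ∧ A.1 1 0 = 0) ∨ (A.1 0 0 = 0 ∧ A.1 1 1 = 0)}
  one_mem' := by left; simp
  mul_mem' := by
    intro A B hA hB
    simp only [Set.mem_ofPred_eq, Matrix.SpecialLinearGroup.coe_mul, Matrix.mul_apply,
      Fin.sum_univ_two] at *
    rcases hA with ⟨h1, h2⟩ | ⟨h1, h2⟩ <;> rcases hB with ⟨h3, h4⟩ | ⟨h3, h4⟩ <;>
      simp [h1, h2, h3, h4]
  inv_mem' := by
    intro A hA
    simp only [Set.mem_ofPred_eq] at *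
    rw [Matrix.SpecialLinearGroup.SL2_inv_expl]
    rcases hA with ⟨h1, h2⟩ | ⟨h1, h2⟩ <;> simp [h1, h2]

lemma mem_monoSub {F : Type*} [Field F] {a b c d : F} {h : a * d - b * c = 1} :
    mkSL a b c d h ∈ monoSub F ↔ (b = 0 ∧ c = 0) ∨ (a = 0 ∧ d = 0) := by
  change ((_ ∧ _) ∨ (_ ∧ _)) ↔ _
  simp [mkSL]

lemma monoSub_isCoatom (F : Type*) [Field F] [Fintype F] [CharP F 2] : IsCoatom (monoSub F) := by
  have hch : ∀ x : F, x + x = 0 := fun x => CharTwo.add_self_eq_zero x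
  have hneg : ∀ x : F, -x = x := fun x => CharTwo.neg_eq x
  have h11 : (0 : F) * 0 - 1 * 1 = 1 := by rw [zero_mul, zero_sub, hneg, one_mul]
  constructor
  · intro htop
    have : mkSL (1 : F) 1 0 1 (by simp) ∈ monoSub F := by rw [htop]; trivial
    rw [mem_monoSub] at this
    simp at this
  · intro X hX
    obtain ⟨hle, g, hgX, hgN⟩ := SetLike.lt_iff_le_and_exists.1 hX
    have hdiag : ∀ (a d : F) (h : a * d - 0 * 0 = 1), mkSL a 0 0 d h ∈ X := fun a d h =>
      hle (mem_monoSub.2 (by simp))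
    have hanti : ∀ (b c : F) (h : 0 * 0 - b * c = 1), mkSL 0 b c 0 h ∈ X := fun b c h =>
      hle (mem_monoSub.2 (by simp))
    -- a unipotent element
    have hu : ∃ u : F, u ≠ 0 ∧ mkSL 1 u 0 1 (by simp) ∈ X := by
      obtain ⟨a, b, c, d, h, rfl⟩ := eq_mkSL g
      rw [mem_monoSub] at hgN
      by_cases hc : c = 0
      · subst hc
        have hb : b ≠ 0 := by rintro rfl; simp at hgN
        have hd : a * d = 1 := by linear_combination h
        have ha : a ≠ 0 := by rintro rfl; simp at hd
        have hd0 : d ≠ 0 := by rintro rfl; simp at hd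
        refine ⟨b * a, mul_ne_zero hb ha, ?_⟩
        have := X.mul_mem hgX (hdiag d a (by linear_combination hd))
        rw [mkSL_mul] at this
        convert this using 2
        · linear_combination -hd
        · ring
        · ring
        · linear_combination -hd
      · by_cases hd : d = 0
        · subst hd
          have ha : a ≠ 0 := by rintro rfl; simp at hgN
          have hbc : b * c = 1 := by
            have : -(b * c) = 1 := by linear_combination h
            rwa [hneg] at this
          refine ⟨a * b, mul_ne_zero ha (by rintro rfl; simp at hbc), ?_⟩
          have := X.mul_mem hgX (hanti b c (by rw [zero_mul, zero_sub, hneg, hbc]))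
          rw [mkSL_mul] at this
          convert this using 2
          · linear_combination -hbc
          · ring
          · ring
          · linear_combination -hbc
        · refine ⟨1 / (c * d), by simp [hc, hd], ?_⟩
          have hw : mkSL 0 (d / c) (c / d) 0
              (by rw [zero_mul, zero_sub, hneg]; field_simp) ∈ X := hanti _ _ _
          have := X.mul_mem (X.mul_mem hgX hw) (X.inv_mem hgX)
          rw [mkSL_inv, mkSL_mul, mkSL_mul] at this
          convert this using 2
          · field_simp
            linear_combination -h + hch (a * d) - hch (b * c)
          · field_simp
            have h1 : a * d = 1 + b * c := by linear_combination h
            linear_combination (-a*d - 1 - b*c) * h1 - hch (b * c)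
          · field_simp
            ring
          · field_simp
            linear_combination -h
    obtain ⟨u, hu0, huX⟩ := hu
    have hU : ∀ x : F, mkSL 1 x 0 1 (by simp) ∈ X := by
      intro x
      by_cases hx : x = 0
      · subst hx; rw [← mkSL_one]; exact one_mem _
      obtain ⟨s, hs⟩ : ∃ s : F, s ^ 2 = x / u := by
        obtain ⟨s, hs⟩ := FiniteField.isSquare_of_char_two (ringChar.eq F 2) (x / u)
        exact ⟨s, by rw [hs, sq]⟩
      have hs0 : s ≠ 0 := by
        rintro rfl
        have : x / u ≠ 0 := div_ne_zero hx hu0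
        apply this; rw [← hs]; simp
      have hxs : x = s ^ 2 * u := by rw [hs]; field_simp
      have := X.mul_mem (X.mul_mem (hdiag s s⁻¹ (by field_simp; ring)) huX)
        (hdiag s⁻¹ s (by field_simp; ring))
      rw [mkSL_mul, mkSL_mul] at this
      convert this using 2
      · field_simp; ring
      · rw [hxs]; ring
      · ring
      · field_simp; ring
    rw [eq_top_iff]
    intro A _
    obtain ⟨a, b, c, d, h, rfl⟩ := eq_mkSL A
    have main : ∀ (a b c d : F) (h : a * d - b * c = 1), c ≠ 0 → mkSL a b c d h ∈ X := by
      intro a b c d h hc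
      have := X.mul_mem (X.mul_mem (hU (a / c)) (hanti c⁻¹ c
        (by rw [zero_mul, zero_sub, hneg]; field_simp))) (hU (d / c))
      rw [mkSL_mul, mkSL_mul] at this
      convert this using 2
      · field_simp; ring
      · field_simp
        linear_combination -h - hch 1
      · ring
      · field_simp; ring
    by_cases hc : c = 0
    · subst hc
      have hd0 : d ≠ 0 := by rintro rfl; simp at h
      have := X.mul_mem (main b a d 0 (by
        have : a * d = 1 := by linear_combination h
        rw [mul_zero, zero_sub, hneg, this]) hd0) (hanti 1 1 h11)
      rw [mkSL_mul] at this
      convert this using 2 <;> ring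
    · exact main a b c d h hc

lemma even_sl2 (F : Type*) [Field F] [Fintype F] [CharP F 2] (hcard : 2 < Fintype.card F) :
    ∃ H K : Subgroup (Matrix.SpecialLinearGroup (Fin 2) F),
      IsPronormal H ∧ IsPronormal K ∧ ¬ IsPronormal (H ⊓ K) := by
  have hfact : Fact (Nat.Prime 2) := ⟨Nat.prime_two⟩
  have hch : ∀ x : F, x + x = 0 := fun x => CharTwo.add_self_eq_zero x
  have hneg : ∀ x : F, -x = x := fun x => CharTwo.neg_eq x
  have h11 : (0 : F) * 0 - 1 * 1 = 1 := by rw [zero_mul, zero_sub, hneg, one_mul]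
  obtain ⟨w, hw⟩ : ∃ w, w = mkSL 0 1 1 0 h11 := ⟨_, rfl⟩
  have hww : w * w = 1 := by
    rw [hw, mkSL_mul, mkSL_one, mkSL_inj]; simp
  have hw1 : w ≠ 1 := by
    rw [hw, mkSL_one, Ne, mkSL_inj]; simp
  have hwN : w ∈ monoSub F := by rw [hw, mem_monoSub]; simp
  have hwp : IsPGroup 2 (Subgroup.zpowers w) := by
    apply IsPGroup.of_card (n := 1)
    rw [Nat.card_zpowers, pow_one]
    exact orderOf_eq_prime (by rw [sq, hww]) hw1
  obtain ⟨S, hS⟩ := hwp.exists_le_sylow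
  have hwS : w ∈ S := hS (Subgroup.mem_zpowers w)
  have hdiagS : ∀ (a d : F) (h : a * d - 0 * 0 = 1), mkSL a 0 0 d h ∈ S → a = 1 ∧ d = 1 := by
    intro a d h hm
    obtain ⟨k, hk⟩ := S.isPGroup' ⟨_, hm⟩
    have hk' : (mkSL a 0 0 d h) ^ 2 ^ k = 1 := congrArg Subtype.val hk
    have hpow : ∀ (m : ℕ), ((mkSL a 0 0 d h) ^ m) =
        mkSL (a ^ m) 0 0 (d ^ m) (by
          rw [← mul_pow, mul_zero, sub_zero, show a * d = 1 by linear_combination h,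
            one_pow]) := by
      intro m
      induction m with
      | zero => simp [mkSL_one]
      | succ m ih => rw [pow_succ, ih, mkSL_mul, mkSL_inj]; simp [pow_succ]
    rw [hpow, mkSL_one, mkSL_inj] at hk'
    have hfr : ∀ x : F, x ^ 2 ^ k = 1 → x = 1 := by
      intro x hx
      have : (x - 1) ^ 2 ^ k = 0 := by rw [sub_pow_char_pow, hx]; simp
      exact sub_eq_zero.1 (pow_eq_zero_iff (by positivity) |>.1 this)
    exact ⟨hfr a hk'.1, hfr d hk'.2.2.2⟩
  obtain ⟨s, hs0, hs1⟩ : ∃ s : F, s ≠ 0 ∧ s ≠ 1 := by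
    classical
    by_contra! hcon
    have : (Finset.univ : Finset F) ⊆ {0, 1} := by
      intro x _
      by_cases hx : x = 0
      · simp [hx]
      · simp [hcon x hx]
    have := Finset.card_le_card this
    rw [Finset.card_univ] at this
    have := this.trans Finset.card_le_two
    omega
  have hs2 : s ^ 2 ≠ 1 := by
    intro h
    have : (s - 1) ^ 2 = 0 := by rw [sub_sq]; linear_combination h + hch 1 - hch s
    exact hs1 (sub_eq_zero.1 (pow_eq_zero_iff two_ne_zero |>.1 this))
  obtain ⟨v, hv⟩ : ∃ v, v = mkSL (1 + s ^ 2) (s ^ 2) (s ^ 2) (1 + s ^ 2)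
      (by linear_combination hch (s ^ 2)) := ⟨_, rfl⟩
  have hg : ∃ g, g * w * g⁻¹ = v := by
    refine ⟨mkSL s 0 (s + s⁻¹) s⁻¹ (by field_simp; ring), ?_⟩
    rw [mul_inv_eq_iff_eq_mul, hw, hv, mkSL_mul, mkSL_mul, mkSL_inj]
    refine ⟨?_, ?_, ?_, ?_⟩
    · field_simp
      linear_combination -hch s - hch (s^3)
    · field_simp
      ring
    · field_simp
      linear_combination -hch (s^2) - hch (s^4)
    · field_simp
      ring
  obtain ⟨g, hg⟩ := hg
  refine ⟨monoSub F, S, isPronormal_of_isCoatom _ (monoSub_isCoatom F), sylow_isPronormal S,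
    not_isPronormal _ w g⁻¹ ?_ hw1 ?_ ?_⟩
  · intro x
    constructor
    · rintro ⟨hxN, hxS⟩
      obtain ⟨a, b, c, d, h, rfl⟩ := eq_mkSL x
      have hxN' := mem_monoSub.1 hxN
      rcases hxN' with ⟨rfl, rfl⟩ | ⟨rfl, rfl⟩
      · left
        obtain ⟨rfl, rfl⟩ := hdiagS _ _ _ hxS
        rw [mkSL_one]
      · right
        have h1 := mul_mem (show mkSL 0 b c 0 h ∈ S from hxS) hwS
        have h2 : mkSL 0 b c 0 h * w = mkSL b 0 0 c (by
            have : -(b * c) = 1 := by linear_combination h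
            rw [hneg] at this; linear_combination this) := by
          rw [hw, mkSL_mul, mkSL_inj]; simp
        rw [h2] at h1
        obtain ⟨rfl, rfl⟩ := hdiagS _ _ _ h1
        exact hw.symm
    · rintro (rfl | rfl)
      · exact one_mem _
      · exact ⟨hwN, hwS⟩
  · rw [inv_inv, hg, hv, hw, Ne, mkSL_inj]
    rintro ⟨_, h, _, _⟩
    exact hs2 h
  · rw [inv_inv, hg, hv, hw]
    unfold Commute SemiconjBy
    rw [mkSL_mul, mkSL_mul, mkSL_inj]
    refine ⟨?_, ?_, ?_, ?_⟩ <;> ring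

lemma even_case (F : Type*) [Field F] [Fintype F] [CharP F 2] (hcard : 2 < Fintype.card F) :
    ∃ H K : Subgroup (Matrix.ProjectiveSpecialLinearGroup (Fin 2) F),
      IsPronormal H ∧ IsPronormal K ∧ ¬ IsPronormal (H ⊓ K) := by
  have hc : Subgroup.center (Matrix.SpecialLinearGroup (Fin 2) F) = ⊥ := by
    rw [eq_bot_iff]
    intro A hA
    rw [Subgroup.mem_bot]
    rcases (mem_center_sl2 A).1 hA with h | h
    · exact h
    · rw [h, mkSL_one, mkSL_neg, mkSL_inj]
      simp [CharTwo.neg_eq]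
  refine transport (MulEquiv.ofBijective (QuotientGroup.mk' (Subgroup.center
    (Matrix.SpecialLinearGroup (Fin 2) F))) ⟨?_, QuotientGroup.mk'_surjective _⟩)
    (even_sl2 F hcard)
  rw [← MonoidHom.ker_eq_bot_iff, QuotientGroup.ker_mk', hc]

theorem stmt7 (p n q : ℕ) (hp : p.Prime) (hq : q = p ^ n)
    (hcases :
      (p = 2 ∧ n.Prime) ∨
      (p = 3 ∧ n.Prime ∧ Odd n) ∨
      (n = 1 ∧ q.Prime ∧ (q % 8 = 3 ∨ q % 8 = 5) ∧ 17 < q) ∨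
      (q = 7 ∨ q = 17) ∨
      (n = 1 ∧ q.Prime ∧ (q % 8 = 1 ∨ q % 8 = 7) ∧
        ((∃ m : ℕ, q - 1 = 2 ^ m) ∨ (∃ m : ℕ, q + 1 = 2 ^ m))))
    (F : Type*) [Field F] [Fintype F] (hF : Fintype.card F = q) :
    ∃ H K : Subgroup (Matrix.ProjectiveSpecialLinearGroup (Fin 2) F),
      IsPronormal H ∧ IsPronormal K ∧ ¬ IsPronormal (H ⊓ K) := by
  have hp' : Fact p.Prime := ⟨hp⟩
  by_cases hp2 : p = 2
  · subst hp2
    have hn : n ≠ 0 := by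
      rintro rfl
      have h1 : 1 < Fintype.card F := Fintype.one_lt_card
      rw [hF, hq] at h1; simp at h1
    have hchar : CharP F 2 := charP_of_card_eq_prime_pow (hF.trans hq)
    apply even_case
    have hn2 : 2 ≤ n := by
      by_contra hlt
      obtain rfl : n = 1 := by omega
      rw [pow_one] at hq
      subst hq
      rcases hcases with h | h | h | h | h
      · exact Nat.not_prime_one h.2
      · omega
      · omega
      · omega
      · omega
    rw [hF, hq]
    calc 2 < 2 ^ 2 := by norm_num
      _ ≤ 2 ^ n := Nat.pow_le_pow_right (by norm_num) hn2
  · have hodd : Odd p := hp.odd_of_ne_two hp2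
    have hqodd : q % 2 = 1 := by rw [hq]; exact Nat.odd_iff.1 hodd.pow
    have hn : n ≠ 0 := by
      rintro rfl
      have h1 : 1 < Fintype.card F := Fintype.one_lt_card
      rw [hF, hq] at h1; simp at h1
    have hq5 : 5 < q := by
      rcases hcases with h | h | h | h | h
      · omega
      · obtain ⟨rfl, hnp, hno⟩ := h
        have h3 : 3 ≤ n := by
          have := hnp.two_le
          obtain ⟨k, hk⟩ := hno
          omega
        rw [hq]
        calc 5 < 3 ^ 3 := by norm_num
          _ ≤ 3 ^ n := Nat.pow_le_pow_right (by norm_num) h3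
      · omega
      · omega
      · have := h.2.1.two_le
        omega
    have hchar : CharP F p := charP_of_card_eq_prime_pow (hF.trans hq)
    apply odd_case
    · intro h2
      have h2' : ((2 : ℕ) : F) = 0 := by exact_mod_cast h2
      rw [CharP.cast_eq_zero_iff F p] at h2'
      exact hp2 ((Nat.prime_dvd_prime_iff_eq hp Nat.prime_two).1 h2')
    · rw [hF]; exact hqodd
    · rw [hF]; exact hq5
end

section
/- Let q = p^n with p prime, set o := gcd(q − 1, 2), and let G = PSL(2, F_q). Let d ≥ 1 be an odd integer such that d divides (q − 1)/o or d divides (q + 1)/o. Then every cyclic subgroup of G of order d is pronormal in G. -/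
/-- Any two subgroups of equal order centralizing an element of order `r` coincide. -/
def UniqProp (M : Type*) [Group M] (r : ℕ) : Prop :=
  ∀ z : M, orderOf z = r → ∀ A B : Subgroup M, A ≤ Subgroup.centralizer {z} →
    B ≤ Subgroup.centralizer {z} → Nat.card A = Nat.card B → A = B

lemma eq_of_card_eq_of_le_cyclic {M : Type*} [Group M] [Finite M] (C A B : Subgroup M)
    [hC : IsCyclic C] (hA : A ≤ C) (hB : B ≤ C) (h : Nat.card A = Nat.card B) : A = B := by
  classical
  have key : ∀ D : Subgroup M, D ≤ C → ∀ x : C, x ^ Nat.card D = 1 → (x : M) ∈ D := by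
    intro D hD x hx
    have := Fintype.ofFinite C
    have h1 := IsCyclic.card_pow_eq_one_le (α := C) (n := Nat.card D) Nat.card_pos
    have h2 : (Finset.univ.filter fun a : C => (a : M) ∈ D) ⊆
        (Finset.univ.filter fun a : C => a ^ Nat.card D = 1) := by
      intro a ha
      simp only [Finset.mem_filter, Finset.mem_univ, true_and] at ha ⊢
      have := pow_card_eq_one' (x := (⟨a, ha⟩ : D))
      ext
      simpa only [Subgroup.coe_pow, Subgroup.coe_one] using congrArg (Subtype.val : D → M) this
    have h3 : (Finset.univ.filter fun a : C => (a : M) ∈ D).card = Nat.card D := by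
      have e : {a : C // (a : M) ∈ D} ≃ D :=
        { toFun := fun a => ⟨a.1, a.2⟩
          invFun := fun a => ⟨⟨a.1, hD a.2⟩, a.2⟩
          left_inv := fun a => rfl
          right_inv := fun a => rfl }
      rw [← Nat.card_congr e, Nat.card_eq_fintype_card, Fintype.card_subtype]
    have h4 := Finset.eq_of_subset_of_card_le h2 (by rw [h3]; exact h1)
    have : x ∈ (Finset.univ.filter fun a : C => (a : M) ∈ D) := by
      rw [h4]; simpa using hx
    simpa using this
  apply Subgroup.eq_of_le_of_card_ge _ h.ge
  intro x hx
  apply key B hB ⟨x, hA hx⟩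
  have := pow_card_eq_one' (x := (⟨x, hx⟩ : A))
  rw [← h]
  ext
  simpa only [Subgroup.coe_pow, Subgroup.coe_one] using congrArg (Subtype.val : A → M) this

lemma UniqProp.subgroup {M : Type*} [Group M] {r : ℕ} (h : UniqProp M r) (J : Subgroup M) :
    UniqProp J r := by
  intro z hz A B hA hB hc
  have key : ∀ D : Subgroup J, D ≤ Subgroup.centralizer {z} →
      D.map J.subtype ≤ Subgroup.centralizer {(z : M)} := by
    rintro D hD _ ⟨x, hx, rfl⟩
    have := hD hx
    rw [Subgroup.mem_centralizer_singleton_iff] at this ⊢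
    simpa using congrArg Subtype.val this
  apply Subgroup.map_injective J.subtype_injective
  apply h z (by simpa using hz) _ _ (key A hA) (key B hB)
  rw [Subgroup.card_map_of_injective J.subtype_injective,
    Subgroup.card_map_of_injective J.subtype_injective, hc]

lemma exists_conj_zpowers {M : Type*} [Group M] [Finite M] {r : ℕ} (hr : r.Prime)
    (h : UniqProp M r) (a b : M) (ha : orderOf a = r) (hb : orderOf b = r) :
    ∃ x : M, Subgroup.zpowers (x * a * x⁻¹) = Subgroup.zpowers b := by
  have : Fact r.Prime := ⟨hr⟩
  have pg : ∀ c : M, orderOf c = r → IsPGroup r (Subgroup.zpowers c) := by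
    intro c hc
    apply IsPGroup.of_card (n := 1)
    rw [Nat.card_zpowers, hc, pow_one]
  obtain ⟨P, hP⟩ := (pg a ha).exists_le_sylow
  obtain ⟨Q, hQ⟩ := (pg b hb).exists_le_sylow
  obtain ⟨x, hx⟩ := MulAction.exists_smul_eq M P Q
  have hbQ : b ∈ Q := hQ (Subgroup.mem_zpowers b)
  have haQ : x * a * x⁻¹ ∈ Q := by
    rw [← hx]
    have : a ∈ P := hP (Subgroup.mem_zpowers a)
    have := Subgroup.smul_mem_pointwise_smul a (MulAut.conj x) (P : Subgroup M) this
    exact this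
  have hne : Nontrivial Q := by
    refine ⟨⟨⟨b, hbQ⟩, 1, fun e => ?_⟩⟩
    have : b = 1 := congrArg Subtype.val e
    rw [this, orderOf_one] at hb
    exact hr.one_lt.ne hb
  have hcn : Nontrivial (Subgroup.center Q) := Q.isPGroup'.center_nontrivial
  have hcp : IsPGroup r (Subgroup.center Q) := Q.isPGroup'.to_subgroup _
  obtain ⟨n, hn, hcard⟩ := (IsPGroup.nontrivial_iff_card hcp).1 hcn
  obtain ⟨z, hz⟩ := exists_prime_orderOf_dvd_card' (G := Subgroup.center Q) r
    (by rw [hcard]; exact dvd_pow_self _ (by omega))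
  have hzM : orderOf ((z : Q) : M) = r :=
    (Subgroup.orderOf_coe _).trans ((Subgroup.orderOf_coe z).trans hz)
  have hQz : ∀ y ∈ Q, y ∈ Subgroup.centralizer {((z : Q) : M)} := by
    intro y hy
    rw [Subgroup.mem_centralizer_singleton_iff]
    have := Subgroup.mem_center_iff.1 z.2 ⟨y, hy⟩
    simpa using congrArg Subtype.val this
  refine ⟨x, h _ hzM _ _ ?_ ?_ ?_⟩
  · rw [Subgroup.zpowers_le]; exact hQz _ haQ
  · rw [Subgroup.zpowers_le]; exact hQz _ hbQ
  · rw [Nat.card_zpowers, Nat.card_zpowers, hb, ← ha]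
    exact (orderOf_injective (MulAut.conj x).toMonoidHom (MulAut.conj x).injective a)

lemma pronormal_of_uniqProp {M : Type*} [Group M] [Finite M] (H : Subgroup M)
    (hcyc : IsCyclic H) (hu : ∀ r : ℕ, r.Prime → r ∣ Nat.card H → UniqProp M r) :
    IsPronormal H := by
  intro g
  by_cases h1 : Nat.card H = 1
  · have : H = ⊥ := Subgroup.card_eq_one.1 h1
    subst this
    exact ⟨1, one_mem _, by simp [Subgroup.conjugate]⟩
  obtain ⟨r, hr, hrd⟩ := Nat.exists_prime_and_dvd h1
  have : Fact r.Prime := ⟨hr⟩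
  have hU := hu r hr hrd
  obtain ⟨a, ha⟩ := exists_prime_orderOf_dvd_card' (G := H) r hrd
  set K := H.conjugate g with hK
  have cardc : ∀ y : M, Nat.card (H.conjugate y) = Nat.card H := fun y =>
    Subgroup.card_map_of_injective (MulAut.conj y⁻¹).injective
  have memc : ∀ y c : M, c ∈ H → y⁻¹ * c * y ∈ H.conjugate y := fun y c hc =>
    ⟨c, hc, by simp⟩
  have commH : ∀ c ∈ H, ∀ e ∈ H, c * e = e * c := by
    intro c hc e he
    let := hcyc.commGroup
    simpa using congrArg Subtype.val (mul_comm (⟨c, hc⟩ : H) ⟨e, he⟩)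
  have cent : ∀ y c : M, c ∈ H.conjugate y → H.conjugate y ≤ Subgroup.centralizer {c} := by
    rintro y _ ⟨c, hc, rfl⟩ _ ⟨e, he, rfl⟩
    rw [Subgroup.mem_centralizer_singleton_iff, ← map_mul, ← map_mul, commH e he c hc]
  have hb : orderOf (g⁻¹ * a * g) = r := by
    have := orderOf_injective (MulAut.conj g⁻¹).toMonoidHom (MulAut.conj g⁻¹).injective (a : M)
    simp only [MulEquiv.toMonoidHom_eq_coe, MonoidHom.coe_coe, MulAut.conj_apply, inv_inv] at this
    rw [this]; simpa using ha
  have haJ : (a : M) ∈ H ⊔ K := (le_sup_left : H ≤ H ⊔ K) a.2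
  have hbK : g⁻¹ * a * g ∈ K := memc g a a.2
  have hbJ : g⁻¹ * a * g ∈ H ⊔ K := (le_sup_right : K ≤ H ⊔ K) hbK
  obtain ⟨x, hx⟩ := exists_conj_zpowers hr (hU.subgroup (H ⊔ K)) ⟨a, haJ⟩ ⟨_, hbJ⟩
    (by rw [← ha, Subgroup.orderOf_mk]; simp) (by rw [Subgroup.orderOf_mk]; exact hb)
  refine ⟨(x : M)⁻¹, inv_mem x.2, ?_⟩
  apply hU _ hb _ _ _ (cent g _ hbK) (by rw [cardc, cardc])
  apply cent
  have hm : (⟨_, hbJ⟩ : (H ⊔ K : Subgroup M)) ∈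
      Subgroup.zpowers (x * ⟨a, haJ⟩ * x⁻¹) := by
    rw [hx]; exact Subgroup.mem_zpowers _
  obtain ⟨k, hk⟩ := hm
  have hk' := congrArg Subtype.val hk
  simp only [Subgroup.coe_zpow, Subgroup.coe_mul, Subgroup.coe_inv] at hk'
  rw [← hk']
  apply zpow_mem
  simpa using memc (x : M)⁻¹ a a.2

open Matrix in
/-- A matrix commuting with a nonscalar `2 × 2` matrix is a polynomial in it. -/
lemma eq_add_smul_of_commute {F : Type*} [Field F] (Z A : Matrix (Fin 2) (Fin 2) F)
    (hZ : ¬ ∃ s : F, Z = s • (1 : Matrix (Fin 2) (Fin 2) F)) (h : A * Z = Z * A) :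
    ∃ a b : F, A = a • (1 : Matrix (Fin 2) (Fin 2) F) + b • Z := by
  have e := fun i j => congrFun (congrFun h i) j
  have e00 := e 0 0
  have e01 := e 0 1
  have e10 := e 1 0
  simp only [Matrix.mul_apply, Fin.sum_univ_two] at e00 e01 e10
  have fin : ∀ a b : F, A 0 0 = a + b * Z 0 0 → A 0 1 = b * Z 0 1 → A 1 0 = b * Z 1 0 →
      A 1 1 = a + b * Z 1 1 → A = a • (1 : Matrix (Fin 2) (Fin 2) F) + b • Z := by
    intro a b h1 h2 h3 h4
    ext i j
    fin_cases i <;> fin_cases j <;> simp [h1, h2, h3, h4]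
  by_cases hβ : Z 0 1 = 0
  · by_cases hγ : Z 1 0 = 0
    · have hd : Z 0 0 - Z 1 1 ≠ 0 := by
        intro hd
        apply hZ
        refine ⟨Z 0 0, ?_⟩
        ext i j
        fin_cases i <;> fin_cases j <;> simp [hβ, hγ]
        linear_combination -hd
      refine ⟨A 0 0 - (A 0 0 - A 1 1) / (Z 0 0 - Z 1 1) * Z 0 0,
        (A 0 0 - A 1 1) / (Z 0 0 - Z 1 1), fin _ _ ?_ ?_ ?_ ?_⟩
      · ring
      · have : A 0 1 * (Z 0 0 - Z 1 1) = 0 := by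
          linear_combination -e01 + (A 0 0 - A 1 1) * hβ
        simp [hβ, (mul_eq_zero.1 this).resolve_right hd]
      · have : A 1 0 * (Z 0 0 - Z 1 1) = 0 := by
          linear_combination e10 + (A 0 0 - A 1 1) * hγ
        simp [hγ, (mul_eq_zero.1 this).resolve_right hd]
      · field_simp
        ring
    · refine ⟨A 0 0 - A 1 0 / Z 1 0 * Z 0 0, A 1 0 / Z 1 0, fin _ _ ?_ ?_ ?_ ?_⟩
      · ring
      · field_simp
        linear_combination e00
      · field_simp
      · field_simp
        linear_combination e10
  · refine ⟨A 0 0 - A 0 1 / Z 0 1 * Z 0 0, A 0 1 / Z 0 1, fin _ _ ?_ ?_ ?_ ?_⟩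
    · ring
    · field_simp
    · field_simp
      linear_combination -e00
    · field_simp
      linear_combination -e01

open Matrix in
lemma pow_aux {R : Type*} [CommRing R] (Z : Matrix (Fin 2) (Fin 2) R) (l : R)
    (h : (Z - l • (1 : Matrix (Fin 2) (Fin 2) R)) * (Z - l • (1 : Matrix (Fin 2) (Fin 2) R)) = 0)
    (k : ℕ) : Z ^ (k + 1) = l ^ (k + 1) • (1 : Matrix (Fin 2) (Fin 2) R) +
      ((k + 1 : ℕ) * l ^ k) • (Z - l • (1 : Matrix (Fin 2) (Fin 2) R)) := by
  have hZZ : Z * Z = (2 * l) • Z - (l * l) • (1 : Matrix (Fin 2) (Fin 2) R) := by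
    simp only [sub_mul, mul_sub, smul_mul_assoc, mul_smul_comm, one_mul, mul_one, smul_sub,
      smul_smul] at h
    rw [← sub_eq_zero, ← h]
    module
  induction k with
  | zero => simp
  | succ k ih =>
    rw [pow_succ, ih, add_mul, smul_mul_assoc, smul_mul_assoc, sub_mul, hZZ, smul_mul_assoc,
      one_mul]
    push_cast
    module

open Matrix in
lemma isCyclic_centralizer_SL {F : Type*} [Field F] [Finite F] (Z : Matrix.SpecialLinearGroup (Fin 2) F)
    (hZ : Z ∉ Subgroup.center (Matrix.SpecialLinearGroup (Fin 2) F)) (r : ℕ) (hr : Odd r)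
    (hrF : (r : F) ≠ 0) (hZr : Z ^ r = 1) :
    IsCyclic (Subgroup.centralizer ({Z} : Set (Matrix.SpecialLinearGroup (Fin 2) F))) := by
  classical
  have hns : ¬ ∃ s : F, (Z : Matrix (Fin 2) (Fin 2) F) = s • (1 : Matrix (Fin 2) (Fin 2) F) := by
    rintro ⟨s, hs⟩
    apply hZ
    rw [Subgroup.mem_center_iff]
    intro B
    ext1
    simp [hs]
  let K := AlgebraicClosure F
  let φ : F →+* K := algebraMap F K
  obtain ⟨t, ht⟩ : ∃ t : F, t = Z 0 0 + Z 1 1 := ⟨_, rfl⟩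
  have hdetZ : Z 0 0 * Z 1 1 - Z 0 1 * Z 1 0 = 1 := by
    have := Z.2
    rwa [Matrix.det_fin_two] at this
  -- an eigenvalue
  obtain ⟨l, hl⟩ : ∃ l : K, l * l - φ t * l + 1 = 0 := by
    obtain ⟨l, hl⟩ := IsAlgClosed.exists_root
      (Polynomial.X ^ 2 - Polynomial.C (φ t) * Polynomial.X + Polynomial.C 1 : Polynomial K) (by
        have : (Polynomial.X ^ 2 - Polynomial.C (φ t) * Polynomial.X + Polynomial.C 1 :
          Polynomial K).degree = 2 := by compute_degree!
        rw [this]; decide)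
    refine ⟨l, ?_⟩
    simp [Polynomial.IsRoot] at hl
    linear_combination hl
  have hC : ∀ A : Subgroup.centralizer ({Z} : Set (Matrix.SpecialLinearGroup (Fin 2) F)),
      ∃ ab : F × F, (A.1 : Matrix (Fin 2) (Fin 2) F) =
        ab.1 • (1 : Matrix (Fin 2) (Fin 2) F) + ab.2 • (Z : Matrix (Fin 2) (Fin 2) F) := by
    intro A
    have h := Subgroup.mem_centralizer_singleton_iff.1 A.2
    have h' : (A.1 : Matrix (Fin 2) (Fin 2) F) * Z = Z * A.1 := by
      simpa using congrArg Subtype.val h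
    obtain ⟨a, b, hab⟩ := eq_add_smul_of_commute _ _ hns h'
    exact ⟨(a, b), hab⟩
  choose c hc using hC
  have huniq : ∀ a b a' b' : F,
      a • (1 : Matrix (Fin 2) (Fin 2) F) + b • (Z : Matrix (Fin 2) (Fin 2) F) =
      a' • (1 : Matrix (Fin 2) (Fin 2) F) + b' • (Z : Matrix (Fin 2) (Fin 2) F) →
      a = a' ∧ b = b' := by
    intro a b a' b' h
    have hb : b = b' := by
      by_contra hne
      have hne' : b - b' ≠ 0 := sub_ne_zero.2 hne
      apply hns
      refine ⟨(a' - a) / (b - b'), ?_⟩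
      have : (b - b') • (Z : Matrix (Fin 2) (Fin 2) F) =
          (a' - a) • (1 : Matrix (Fin 2) (Fin 2) F) := by
        rw [sub_smul, sub_smul, sub_eq_sub_iff_add_eq_add, add_comm, h, add_comm]
      rw [div_eq_inv_mul, ← smul_smul, ← this, smul_smul, inv_mul_cancel₀ hne', one_smul]
    subst hb
    refine ⟨?_, rfl⟩
    have h' : a • (1 : Matrix (Fin 2) (Fin 2) F) = a' • (1 : Matrix (Fin 2) (Fin 2) F) :=
      add_right_cancel h
    have := congrFun (congrFun h' 0) 0
    simpa using this
  have hZZ : (Z : Matrix (Fin 2) (Fin 2) F) * Z =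
      t • (Z : Matrix (Fin 2) (Fin 2) F) - (1 : Matrix (Fin 2) (Fin 2) F) := by
    ext i j
    fin_cases i <;> fin_cases j <;> simp [Matrix.mul_apply, Fin.sum_univ_two, ht]
    · linear_combination -hdetZ
    · ring
    · ring
    · linear_combination -hdetZ
  let f : Subgroup.centralizer ({Z} : Set (Matrix.SpecialLinearGroup (Fin 2) F)) →* K :=
    { toFun := fun A => φ (c A).1 + φ (c A).2 * l
      map_one' := by
        have := huniq (c 1).1 (c 1).2 1 0 (by rw [← hc]; simp)
        rw [this.1, this.2]; simp
      map_mul' := by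
        intro A B
        have := huniq (c (A * B)).1 (c (A * B)).2 ((c A).1 * (c B).1 - (c A).2 * (c B).2)
          ((c A).1 * (c B).2 + (c A).2 * (c B).1 + (c A).2 * (c B).2 * t) (by
            have hmul : ((A * B).1 : Matrix (Fin 2) (Fin 2) F) =
              (A.1 : Matrix (Fin 2) (Fin 2) F) * (B.1 : Matrix (Fin 2) (Fin 2) F) := rfl
            rw [← hc, hmul, hc A, hc B]
            simp only [add_mul, mul_add, smul_mul_assoc, mul_smul_comm, hZZ, one_mul, mul_one]
            module)
        rw [this.1, this.2]
        simp only [map_sub, map_add, map_mul]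
        linear_combination (-φ (c A).2 * φ (c B).2) * hl }
  apply isCyclic_of_injective_ringHom f
  rw [injective_iff_map_eq_one]
  intro A hA
  have hA' : φ (c A).1 + φ (c A).2 * l = 1 := hA
  obtain ⟨a, b, hcA⟩ : ∃ a b, c A = (a, b) := ⟨_, _, rfl⟩
  have hAm := hc A
  rw [hcA] at hA' hAm
  simp only at hA' hAm
  by_cases hb : b = 0
  · subst hb
    have ha : a = 1 := by
      apply φ.injective
      simpa using hA'
    ext1
    ext1
    rw [hAm, ha]
    simp
  exfalso
  have hdetA : a * a + a * b * t + b * b = 1 := by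
    have := A.1.2
    rw [Matrix.det_fin_two, hAm] at this
    simp at this
    rw [ht]
    linear_combination this - b * b * hdetZ
  have hdetA' : φ a * φ a + φ a * φ b * φ t + φ b * φ b = 1 := by
    simpa using congrArg φ hdetA
  have hφb : φ b ≠ 0 := by simpa using hb
  have hl0 : l ≠ 0 := by
    rintro rfl
    simp at hl
  -- the trace of `A` is `2`
  have ht2 : φ t = 2 * l := by
    have h1 : φ a = 1 - φ b * l := by linear_combination hA'
    rw [h1] at hdetA'
    have : φ b * (φ t - 2 * l) = 0 := by
      linear_combination hdetA' - φ b * φ b * hl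
    have := (mul_eq_zero.1 this).resolve_left hφb
    linear_combination this
  have hl2 : l * l = 1 := by linear_combination -hl - l * ht2
  -- `l` lies in `F`
  obtain ⟨s, hs⟩ : ∃ s : F, φ s = l := by
    refine ⟨(1 - a) / b, ?_⟩
    rw [map_div₀, div_eq_iff hφb, map_sub, map_one]
    linear_combination -hA'
  have hs2 : s * s = 1 := φ.injective (by rw [map_mul, hs, hl2, map_one])
  have hts : t = 2 * s := φ.injective (by rw [map_mul, hs, ht2, map_ofNat])
  set N : Matrix (Fin 2) (Fin 2) F := (Z : Matrix (Fin 2) (Fin 2) F) - s • 1 with hN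
  have hNN : N * N = 0 := by
    simp only [hN, sub_mul, mul_sub, smul_mul_assoc, mul_smul_comm, one_mul, mul_one, hZZ, hts,
      smul_sub, smul_smul, hs2]
    module
  obtain ⟨k, hk⟩ : ∃ k, r = k + 1 := ⟨r - 1, by obtain ⟨m, hm⟩ := hr; omega⟩
  have hp := pow_aux (Z : Matrix (Fin 2) (Fin 2) F) s hNN k
  rw [← hk, ← Matrix.SpecialLinearGroup.coe_pow, hZr, Matrix.SpecialLinearGroup.coe_one] at hp
  have := huniq 1 0 (s ^ r - r * s ^ k * s) (r * s ^ k) (by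
    rw [one_smul, zero_smul, add_zero]
    refine hp.trans ?_
    module)
  have h0 := this.2.symm
  have hs0 : s ≠ 0 := by rintro rfl; simp at hs2
  exact mul_ne_zero hrF (pow_ne_zero _ hs0) h0

open Matrix in
lemma uniqProp_PSL {F : Type*} [Field F] [Finite F] (r : ℕ) (hrp : r.Prime) (hr : Odd r)
    (hrF : (r : F) ≠ 0) : UniqProp (ProjectiveSpecialLinearGroup (Fin 2) F) r := by
  intro z hz A B hA hB hAB
  have hc2 : ∀ c ∈ Subgroup.center (Matrix.SpecialLinearGroup (Fin 2) F), c * c = 1 := by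
    intro c hc
    obtain ⟨s, hs, hs'⟩ := Matrix.SpecialLinearGroup.mem_center_iff.1 hc
    ext1
    rw [Matrix.SpecialLinearGroup.coe_mul, ← hs', ← map_mul]
    have : s * s = 1 := by simpa [sq] using hs
    simp [this]
  obtain ⟨m, hm⟩ := hr
  have hodd : ∀ c ∈ Subgroup.center (Matrix.SpecialLinearGroup (Fin 2) F), c ^ r = c := by
    intro c hc
    rw [hm, pow_succ, pow_mul, sq, hc2 c hc, one_pow, one_mul]
  obtain ⟨Z₀, rfl⟩ := QuotientGroup.mk_surjective z
  have hZ₀ : Z₀ ^ r ∈ Subgroup.center (Matrix.SpecialLinearGroup (Fin 2) F) := by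
    rw [← QuotientGroup.eq_one_iff, QuotientGroup.mk_pow, ← hz, pow_orderOf_eq_one]
  obtain ⟨Z, hZ⟩ : ∃ Z, Z = Z₀ * Z₀ ^ r := ⟨_, rfl⟩
  have hZz : (QuotientGroup.mk Z₀ : ProjectiveSpecialLinearGroup (Fin 2) F) =
      QuotientGroup.mk Z := by
    rw [QuotientGroup.eq, hZ, inv_mul_cancel_left]; exact hZ₀
  have hZr : Z ^ r = 1 := by
    rw [hZ, (Commute.self_pow Z₀ r).mul_pow, hodd _ hZ₀, hc2 _ hZ₀]
  rw [hZz] at hz hA hB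
  have hZn : Z ∉ Subgroup.center (Matrix.SpecialLinearGroup (Fin 2) F) := by
    intro h
    rw [(QuotientGroup.eq_one_iff Z).2 h, orderOf_one] at hz
    exact hrp.one_lt.ne hz
  have hcyc := isCyclic_centralizer_SL Z hZn r ⟨m, hm⟩ hrF hZr
  let C := (Subgroup.centralizer ({Z} : Set (Matrix.SpecialLinearGroup (Fin 2) F))).map
    (QuotientGroup.mk' (Subgroup.center (Matrix.SpecialLinearGroup (Fin 2) F)))
  have hCc : IsCyclic C := isCyclic_of_surjective _
    ((QuotientGroup.mk' (Subgroup.center (Matrix.SpecialLinearGroup (Fin 2) F))).subgroupMap_surjective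
      (Subgroup.centralizer ({Z} : Set (Matrix.SpecialLinearGroup (Fin 2) F))))
  have hle : Subgroup.centralizer {(QuotientGroup.mk Z : ProjectiveSpecialLinearGroup (Fin 2) F)}
      ≤ C := by
    intro g hg
    obtain ⟨g, rfl⟩ := QuotientGroup.mk_surjective g
    refine ⟨g, ?_, rfl⟩
    rw [SetLike.mem_coe, Subgroup.mem_centralizer_singleton_iff]
    rw [Subgroup.mem_centralizer_singleton_iff, ← QuotientGroup.mk_mul, ← QuotientGroup.mk_mul,
      QuotientGroup.eq] at hg
    obtain ⟨c, hc⟩ : ∃ c, c = (g * Z)⁻¹ * (Z * g) := ⟨_, rfl⟩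
    rw [← hc] at hg
    have hcomm := Subgroup.mem_center_iff.1 hg
    have h1 : g⁻¹ * Z * g = Z * c := by rw [hc]; group
    have h2 : (Z * c) ^ r = 1 := by
      have := conj_pow (i := r) (a := g⁻¹) (b := Z)
      rw [inv_inv, hZr, mul_one, inv_mul_cancel] at this
      rw [← h1, this]
    have h3 : (Z * c) ^ r = c := by
      rw [Commute.mul_pow (hcomm Z), hZr, one_mul, hodd c hg]
    rw [← h3, h2] at hc
    exact (inv_mul_eq_one.1 hc.symm)
  exact eq_of_card_eq_of_le_cyclic C A B (hA.trans hle) (hB.trans hle) hAB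

theorem stmt10 (p n q : ℕ) (hp : p.Prime) (hq : q = p ^ n)
    (o : ℕ) (ho : o = Nat.gcd (q - 1) 2)
    (F : Type*) [Field F] [Fintype F] (hF : Fintype.card F = q)
    (d : ℕ) (hd1 : 1 ≤ d) (hdodd : Odd d)
    (hdvd : d ∣ (q - 1) / o ∨ d ∣ (q + 1) / o)
    (H : Subgroup (Matrix.ProjectiveSpecialLinearGroup (Fin 2) F))
    (hcyc : IsCyclic H) (hcard : Nat.card H = d) :
    IsPronormal H := by
  have hq1 : 1 < q := hF ▸ Fintype.one_lt_card
  have hn : n ≠ 0 := by rintro rfl; simp at hq; omega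
  have hpF : (p : F) = 0 := by
    have h : ((Fintype.card F : ℕ) : F) = 0 := FiniteField.cast_card_eq_zero F
    rw [hF, hq] at h
    push_cast at h
    exact (pow_eq_zero_iff hn).1 h
  have hod : o ∣ q - 1 := ho ▸ Nat.gcd_dvd_left _ _
  have hod2 : o ∣ 2 := ho ▸ Nat.gcd_dvd_right _ _
  have hod' : o ∣ q + 1 := by
    have : q + 1 = (q - 1) + 2 := by omega
    rw [this]; exact dvd_add hod hod2
  have hpq : p ∣ q := hq ▸ dvd_pow_self p hn
  apply pronormal_of_uniqProp H hcyc
  intro r hr hrd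
  rw [hcard] at hrd
  apply uniqProp_PSL r hr (hdodd.of_dvd_nat hrd)
  intro hr0
  have hrp : r = p := by
    by_contra hne
    have hco : Nat.Coprime r p := (Nat.coprime_primes hr hp).2 hne
    have := (Nat.isCoprime_iff_coprime.2 hco)
    obtain ⟨u, v, huv⟩ := this
    have h1 : ((u * r + v * p : ℤ) : F) = 1 := by rw [huv]; simp
    push_cast at h1
    rw [hr0, hpF] at h1
    simp at h1
  subst hrp
  rcases hdvd with h | h
  · have h1 : r ∣ q - 1 := (hrd.trans h).trans (Nat.div_dvd_of_dvd hod)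
    have h2 : r ∣ q - (q - 1) := Nat.dvd_sub hpq h1
    have : q - (q - 1) = 1 := by omega
    rw [this] at h2
    exact hr.one_lt.ne' (Nat.dvd_one.1 h2)
  · have h1 : r ∣ q + 1 := (hrd.trans h).trans (Nat.div_dvd_of_dvd hod')
    exact hr.one_lt.ne' (Nat.dvd_one.1 ((Nat.dvd_add_right hpq).1 h1))
end

section
/- Let q be an odd prime power with q ≡ 1 (mod 8) or q ≡ 7 (mod 8), let G = PSL(2, F_q), and let k be the 2-adic valuation of |G|. Then for every integer j with 1 ≤ j ≤ k − 2, every subgroup of G isomorphic to the dihedral group of order 2^j (with the conventions that the dihedral group of order 2 is ℤ/2ℤ and the dihedral group of order 4 is the Klein four-group) is not pronormal in G. -/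
open Matrix

lemma pron_conj_mem {G : Type*} [Group G] {H : Subgroup G} (h : IsPronormal H) (g : G)
    (hg : H.conjugate g ≤ Subgroup.normalizer (H : Set G)) : H.conjugate g = H := by
  obtain ⟨x, hx, hxg⟩ := h g
  rw [← hxg]
  have hx' : x ∈ Subgroup.normalizer (H : Set G) :=
    (sup_le Subgroup.le_normalizer hg) hx
  have := inv_mem hx'
  exact Subgroup.mem_normalizer_iff_map_conj_eq.mp this

lemma mem_conjugate {G : Type*} [Group G] {H : Subgroup G} {g x : G} :
    x ∈ H.conjugate g ↔ g * x * g⁻¹ ∈ H := by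
  unfold Subgroup.conjugate
  rw [Subgroup.mem_map]
  constructor
  · rintro ⟨y, hy, rfl⟩
    simpa [mul_assoc] using hy
  · intro h
    exact ⟨_, h, by simp [mul_assoc]⟩

lemma pron_normal {G : Type*} [Group G] [Finite G] {H : Subgroup G} (h : IsPronormal H)
    (P : Sylow 2 G) (hP : H ≤ (P : Subgroup G)) :
    (P : Subgroup G) ≤ Subgroup.normalizer (H : Set G) := by
  by_contra hn
  have : Fact (Nat.Prime 2) := ⟨Nat.prime_two⟩
  have : Group.IsNilpotent P := P.isPGroup'.isNilpotent
  let N : Subgroup P := (Subgroup.normalizer (H : Set G)).subgroupOf P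
  have hN : N < ⊤ := by
    rw [lt_top_iff_ne_top]
    intro hN
    exact hn (Subgroup.subgroupOf_eq_top.mp hN)
  have hlt := Group.normalizerCondition_of_isNilpotent N hN
  obtain ⟨g, hg, hgN⟩ := SetLike.exists_of_lt hlt
  apply hgN
  have key : H.conjugate (g : G) ≤ Subgroup.normalizer (H : Set G) := by
    intro x hx
    rw [mem_conjugate] at hx
    have hgx : (g : G) * x * (g : G)⁻¹ ∈ (P : Subgroup G) := hP hx
    have hxP : x ∈ (P : Subgroup G) := by
      have := mul_mem (mul_mem (inv_mem g.2) hgx) g.2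
      simpa [mul_assoc] using this
    have h2 : g * (⟨x, hxP⟩ : P) * g⁻¹ ∈ N := by
      change (g : G) * x * (g : G)⁻¹ ∈ Subgroup.normalizer (H : Set G)
      exact Subgroup.le_normalizer hx
    have := (Subgroup.mem_normalizer_iff.mp hg _).mpr h2
    exact this
  have h3 := pron_conj_mem h _ key
  change (g : G) ∈ Subgroup.normalizer (H : Set G)
  rw [Subgroup.mem_normalizer_iff]
  intro x
  rw [← mem_conjugate, h3]

lemma card_inf_of_index {G : Type*} [Group G] [Finite G] (A P : Subgroup G) (s : G)
    (hs : s ∈ P) (hsA : s ∉ A)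
    (hprod : ∀ x ∈ P, ∀ y ∈ P, x ∉ A → y ∉ A → x * y ∈ A) :
    Nat.card (A ⊓ P : Subgroup G) * 2 = Nat.card P := by
  have h : (A.subgroupOf P).index = 2 := by
    rw [Subgroup.index_eq_two_iff]
    refine ⟨⟨s, hs⟩, fun b => ?_⟩
    by_cases hb : (b : G) ∈ A
    · refine Or.inr ⟨hb, fun hbs => hsA ?_⟩
      have hbs' : (b : G) * s ∈ A := hbs
      simpa using mul_mem (inv_mem hb) hbs'
    · exact Or.inl ⟨hprod _ b.2 _ hs hb hsA, hb⟩
  rw [← Subgroup.card_mul_index (A.subgroupOf P), h, ← Subgroup.inf_subgroupOf_right,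
    Nat.card_congr (Subgroup.subgroupOfEquivOfLe (inf_le_right : A ⊓ P ≤ P)).toEquiv]

lemma counting {G : Type*} [Group G] [Finite G] (P H A : Subgroup G) (z s : G) (hHP : H ≤ P)
    (hPN : P ≤ Subgroup.normalizer (H : Set G))
    (hinv : ∀ x ∈ P, x ∉ A → x * x = 1) (hcomm : ∀ x ∈ A, ∀ y ∈ A, x * y = y * x)
    (h2 : ∀ x ∈ A, x * x = 1 → x = 1 ∨ x = z)
    (hprod : ∀ x ∈ P, ∀ y ∈ P, x ∉ A → y ∉ A → x * y ∈ A)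
    (hs : s ∈ H) (hsA : s ∉ A) : Nat.card P ≤ 2 * Nat.card H := by
  have c1 := card_inf_of_index A P s (hHP hs) hsA hprod
  have c2 := card_inf_of_index A H s hs hsA
    (fun x hx y hy => hprod x (hHP hx) y (hHP hy))
  let f : (A ⊓ P : Subgroup G) →* G :=
    { toFun := fun x => (x : G) * x
      map_one' := by simp
      map_mul' := by
        intro x y
        have := hcomm x x.2.1 y y.2.1
        simp only [Subgroup.coe_mul]
        rw [mul_assoc, ← mul_assoc (y : G), ← this]
        simp only [mul_assoc] }
  have hr : f.range ≤ A ⊓ H := by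
    rintro _ ⟨⟨a, haA, haP⟩, rfl⟩
    change a * a ∈ A ⊓ H
    refine ⟨mul_mem haA haA, ?_⟩
    have hsa : s * a ∉ A := fun hh => hsA (by simpa using mul_mem hh (inv_mem haA))
    have e1 := hinv _ (mul_mem (hHP hs) haP) hsa
    have e2 := hinv _ (hHP hs) hsA
    have e3 : a⁻¹ * s * a ∈ H :=
      (Subgroup.mem_normalizer_iff''.mp (hPN haP) s).mp hs
    have e4 : a * a = s * (a⁻¹ * s * a) := by
      have e5 : s * a * s = a⁻¹ := by
        rw [eq_inv_iff_mul_eq_one]; simpa [mul_assoc] using e1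
      have e6 : s⁻¹ = s := inv_eq_of_mul_eq_one_left e2
      have e7 : s * a⁻¹ * s = a := by
        rw [← e5]
        calc s * (s * a * s) * s = (s * s) * a * (s * s) := by simp only [mul_assoc]
          _ = a := by simp [e2]
      calc a * a = (s * a⁻¹ * s) * a := by rw [e7]
        _ = _ := by simp only [mul_assoc]
    rw [e4]
    exact mul_mem hs e3
  have hk : Nat.card f.ker ≤ 2 := by
    have : (Subtype.val '' (f.ker : Set (A ⊓ P : Subgroup G))) ⊆ {1, z} := by
      rintro _ ⟨x, hx, rfl⟩
      exact h2 x x.2.1 hx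
    calc Nat.card f.ker = (f.ker : Set (A ⊓ P : Subgroup G)).ncard := rfl
      _ = (Subtype.val '' (f.ker : Set (A ⊓ P : Subgroup G))).ncard :=
        (Set.ncard_image_of_injective _ Subtype.val_injective).symm
      _ ≤ ({1, z} : Set G).ncard := Set.ncard_le_ncard this (Set.toFinite _)
      _ ≤ 2 := (Set.ncard_insert_le _ _).trans (by simp)
  have hc : Nat.card f.ker * Nat.card f.range = Nat.card (A ⊓ P : Subgroup G) := by
    rw [← Subgroup.index_ker, Subgroup.card_mul_index]
  have hrc : Nat.card f.range ≤ Nat.card (A ⊓ H : Subgroup G) :=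
    Nat.card_le_card_of_injective _ (Subgroup.inclusion_injective hr)
  have := Nat.mul_le_mul hk hrc
  omega

section SL
variable {F : Type*} [Field F]

local notation "SL2" => Matrix.SpecialLinearGroup (Fin 2)

lemma sl_ext_iff (X Y : SL2 F) : X = Y ↔ X 0 0 = Y 0 0 ∧ X 0 1 = Y 0 1 ∧
    X 1 0 = Y 1 0 ∧ X 1 1 = Y 1 1 := by
  rw [Matrix.SpecialLinearGroup.ext_iff]
  simp [Fin.forall_fin_two, and_assoc]

lemma sl_det (X : SL2 F) : X 0 0 * X 1 1 - X 0 1 * X 1 0 = 1 := by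
  rw [← Matrix.det_fin_two]; exact X.2

lemma sl_mul (X Y : SL2 F) (i j : Fin 2) : (X * Y) i j = X i 0 * Y 0 j + X i 1 * Y 1 j := by
  simp [Matrix.mul_apply, Fin.sum_univ_two]

lemma sl_neg (X : SL2 F) (i j : Fin 2) : (-X) i j = - X i j := by
  simp

lemma sl_one00 : (1 : SL2 F) 0 0 = 1 := by simp
lemma sl_one01 : (1 : SL2 F) 0 1 = 0 := by simp
lemma sl_one10 : (1 : SL2 F) 1 0 = 0 := by simp
lemma sl_one11 : (1 : SL2 F) 1 1 = 1 := by simp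

lemma sl_sq_one (h2 : (2 : F) ≠ 0) (X : SL2 F) (h : X * X = 1) : X = 1 ∨ X = -1 := by
  have hd := sl_det X
  simp only [sl_ext_iff, sl_mul, sl_neg, sl_one00, sl_one01, sl_one10, sl_one11] at *
  grind

lemma sl_sq_neg (X : SL2 F) (h : X * X = -1) : X 1 1 = - X 0 0 := by
  have hd := sl_det X
  simp only [sl_ext_iff, sl_mul, sl_neg, sl_one00, sl_one01, sl_one10, sl_one11] at *
  grind

lemma sl_sq_neg_of (X : SL2 F) (h : X 1 1 = - X 0 0) : X * X = -1 := by
  have hd := sl_det X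
  simp only [sl_ext_iff, sl_mul, sl_neg, sl_one00, sl_one01, sl_one10, sl_one11] at *
  grind

lemma sl_anti (h2 : (2 : F) ≠ 0) (X Z : SL2 F) (hZ : Z * Z = -1) (h : X * Z = - (Z * X)) :
    X * X = -1 := by
  apply sl_sq_neg_of
  have hd := sl_det X
  have hd' := sl_det Z
  have ht := sl_sq_neg Z hZ
  simp only [sl_ext_iff, sl_mul, sl_neg, sl_one00, sl_one01, sl_one10, sl_one11] at *
  grind

lemma sl_comm (h2 : (2 : F) ≠ 0) (X Y Z : SL2 F) (hZ : Z * Z = -1) (h : X * Z = Z * X)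
    (h' : Y * Z = Z * Y) : X * Y = Y * X := by
  have hd' := sl_det Z
  have ht := sl_sq_neg Z hZ
  simp only [sl_ext_iff, sl_mul, sl_neg, sl_one00, sl_one01, sl_one10, sl_one11] at *
  grind

lemma sl_comm_inv (h2 : (2 : F) ≠ 0) (X Z : SL2 F) (hZ : Z * Z = -1) (h : X * Z = Z * X)
    (h' : X * X = -1) : X = Z ∨ X = -Z := by
  have hW : (X * Z) * (X * Z) = 1 := by
    calc (X * Z) * (X * Z) = X * (Z * X) * Z := by simp only [mul_assoc]
      _ = (X * X) * (Z * Z) := by rw [← h]; simp only [mul_assoc]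
      _ = 1 := by rw [h', hZ]; simp
  have e : X = -((X * Z) * Z) := by rw [mul_assoc, hZ]; simp
  rcases sl_sq_one h2 _ hW with h | h <;> rw [h] at e
  · right; simpa using e
  · left; simpa using e

local notation "PSL2" => Matrix.ProjectiveSpecialLinearGroup (Fin 2)

lemma psl_eq (X Y : SL2 F) : (QuotientGroup.mk X : PSL2 F) = QuotientGroup.mk Y ↔
    X = Y ∨ X = -Y := by
  rw [QuotientGroup.eq, Matrix.SpecialLinearGroup.mem_center_iff]
  constructor
  · rintro ⟨r, hr, h⟩
    have hr' : r = 1 ∨ r = -1 := by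
      rw [← sq_eq_one_iff]; simpa using hr
    rcases hr' with rfl | rfl
    · left
      have : X⁻¹ * Y = 1 := by ext i j; rw [← h]; simp
      exact (inv_mul_eq_one.mp this)
    · right
      have : X⁻¹ * Y = -1 := by
        ext i j; rw [← h]
        fin_cases i <;> fin_cases j <;> simp
      rw [inv_mul_eq_iff_eq_mul] at this
      rw [this]; simp
  · rintro (rfl | rfl)
    · exact ⟨1, by simp, by simp⟩
    · refine ⟨-1, by simp, ?_⟩
      have : (-Y)⁻¹ * Y = -1 := by rw [inv_mul_eq_iff_eq_mul]; simp
      rw [this]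
      ext i j
      fin_cases i <;> fin_cases j <;> simp

lemma psl_one (X : SL2 F) : (QuotientGroup.mk X : PSL2 F) = 1 ↔ X = 1 ∨ X = -1 :=
  psl_eq X 1

lemma psl_lift_inv (h2 : (2 : F) ≠ 0) (Z : SL2 F) (h : (QuotientGroup.mk Z : PSL2 F) ≠ 1)
    (h' : (QuotientGroup.mk Z : PSL2 F) * QuotientGroup.mk Z = 1) : Z * Z = -1 := by
  rw [← QuotientGroup.mk_mul, psl_one] at h'
  rcases h' with h' | h'
  · exact absurd ((psl_one _).mpr (sl_sq_one h2 _ h')) h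
  · exact h'

theorem psl_bound [Finite F] (h2 : (2 : F) ≠ 0) (P H : Subgroup (PSL2 F)) (z : PSL2 F)
    (hHP : H ≤ P) (hPN : P ≤ Subgroup.normalizer (H : Set (PSL2 F)))
    (hz : z ≠ 1) (hzz : z * z = 1) (hzP : ∀ x ∈ P, x * z = z * x)
    (s : PSL2 F) (hs : s ∈ H) (hs1 : s ≠ 1) (hss : s * s = 1) (hsz : s ≠ z) :
    Nat.card P ≤ 2 * Nat.card H := by
  obtain ⟨Z, rfl⟩ := QuotientGroup.mk_surjective z
  have hZ := psl_lift_inv h2 Z hz hzz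
  let A : Subgroup (PSL2 F) := (Subgroup.centralizer {Z}).map (QuotientGroup.mk' _)
  have hA : ∀ X : SL2 F, (QuotientGroup.mk X : PSL2 F) ∈ A ↔ X * Z = Z * X := by
    intro X
    constructor
    · rintro ⟨Y, hY, hYX⟩
      have hY' : Y * Z = Z * Y := (Subgroup.mem_centralizer_singleton_iff.mp hY)
      rcases (psl_eq Y X).mp hYX with rfl | rfl
      · exact hY'
      · simpa using hY'
    · intro h
      exact ⟨X, Subgroup.mem_centralizer_singleton_iff.mpr h, rfl⟩
  have hanti : ∀ X : SL2 F, (QuotientGroup.mk X : PSL2 F) ∈ P →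
      (QuotientGroup.mk X : PSL2 F) ∉ A → X * Z = -(Z * X) := by
    intro X hX hXA
    have := hzP _ hX
    rw [← QuotientGroup.mk_mul, ← QuotientGroup.mk_mul, psl_eq] at this
    rw [hA] at hXA
    tauto
  have hA2 : ∀ x ∈ A, x * x = 1 → x = 1 ∨ x = (QuotientGroup.mk Z : PSL2 F) := by
    intro x hx hxx
    obtain ⟨X, rfl⟩ := QuotientGroup.mk_surjective x
    by_cases h1 : (QuotientGroup.mk X : PSL2 F) = 1
    · exact Or.inl h1
    · right
      exact (psl_eq _ _).mpr (sl_comm_inv h2 X Z hZ ((hA X).mp hx) (psl_lift_inv h2 X h1 hxx))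
  refine counting P H A (QuotientGroup.mk Z) s hHP hPN ?_ ?_ hA2 ?_ hs ?_
  · intro x hx hxA
    obtain ⟨X, rfl⟩ := QuotientGroup.mk_surjective x
    rw [← QuotientGroup.mk_mul, psl_one]
    exact Or.inr (sl_anti h2 X Z hZ (hanti X hx hxA))
  · intro x hx y hy
    obtain ⟨X, rfl⟩ := QuotientGroup.mk_surjective x
    obtain ⟨Y, rfl⟩ := QuotientGroup.mk_surjective y
    rw [← QuotientGroup.mk_mul, ← QuotientGroup.mk_mul,
      sl_comm h2 X Y Z hZ ((hA X).mp hx) ((hA Y).mp hy)]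
  · intro x hx y hy hxA hyA
    obtain ⟨X, rfl⟩ := QuotientGroup.mk_surjective x
    obtain ⟨Y, rfl⟩ := QuotientGroup.mk_surjective y
    have e1 := hanti X hx hxA
    have e2 := hanti Y hy hyA
    rw [← QuotientGroup.mk_mul, hA, mul_assoc, e2, mul_neg, ← mul_assoc, e1]
    simp [mul_assoc]
  · intro hsA
    rcases hA2 s hsA hss with h | h
    · exact hs1 h
    · exact hsz h

lemma sl_exists_anti [Finite F] (h2 : (2 : F) ≠ 0) (T : SL2 F) (hT : T * T = -1) :
    ∃ U : SL2 F, U * U = -1 ∧ U * T = -(T * U) := by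
  have ht := sl_sq_neg T hT
  have hd := sl_det T
  suffices h : ∃ x y z : F, x * x + y * z = -1 ∧
      2 * T 0 0 * x + T 0 1 * z + T 1 0 * y = 0 by
    obtain ⟨x, y, z, h1, h3⟩ := h
    let U : SL2 F := ⟨!![x, y; z, -x], by rw [Matrix.det_fin_two_of]; linear_combination -h1⟩
    have u00 : U 0 0 = x := rfl
    have u01 : U 0 1 = y := rfl
    have u10 : U 1 0 = z := rfl
    have u11 : U 1 1 = -x := rfl
    refine ⟨U, sl_sq_neg_of U rfl, ?_⟩
    simp only [sl_ext_iff, sl_mul, sl_neg, u00, u01, u10, u11, ht]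
    refine ⟨?_, ?_, ?_, ?_⟩ <;> first | linear_combination h3 | linear_combination -h3 | ring
  by_cases hb : T 0 1 = 0
  · have ha : T 0 0 ≠ 0 := by intro h; simp [h, hb] at hd
    refine ⟨-T 1 0 / (2 * T 0 0), 1, -1 - (T 1 0 / (2 * T 0 0)) ^ 2, by ring, ?_⟩
    rw [hb]; field_simp; ring
  · have : NeZero (ringChar F) := ⟨CharP.char_ne_zero_of_finite F _⟩
    obtain ⟨a, b, hab⟩ := CharP.sq_add_sq F (ringChar F) (-1)
    have hab' : (a : F) ^ 2 + (b : F) ^ 2 = -1 := by exact_mod_cast hab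
    refine ⟨a + T 0 0 * b, T 0 1 * b, -(2 * T 0 0 * (a + T 0 0 * b) + T 1 0 * (T 0 1 * b)) / T 0 1,
      ?_, ?_⟩
    · field_simp
      rw [ht] at hd
      linear_combination hab' + (b : F) ^ 2 * hd
    · field_simp; ring

lemma sl_conj (h2 : (2 : F) ≠ 0) (hsq : IsSquare (2 : F)) (T U : SL2 F) (hT : T * T = -1)
    (hU : U * U = -1) (h : U * T = -(T * U)) : ∃ g : SL2 F, g * U = T * g := by
  obtain ⟨r, hr⟩ := hsq
  have hr0 : r ≠ 0 := by rintro rfl; simp at hr; exact h2 hr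
  have dT := sl_det T
  have dU := sl_det U
  have tT := sl_sq_neg T hT
  have tU := sl_sq_neg U hU
  simp only [sl_ext_iff, sl_mul, sl_neg, sl_one00, sl_one01, sl_one10, sl_one11] at hT hU h
  let g : SL2 F := ⟨!![(T 0 0 + U 0 0) / r, (T 0 1 + U 0 1) / r;
    (T 1 0 + U 1 0) / r, (T 1 1 + U 1 1) / r], by
      rw [Matrix.det_fin_two_of]
      field_simp
      grind⟩
  have g00 : g 0 0 = (T 0 0 + U 0 0) / r := rfl
  have g01 : g 0 1 = (T 0 1 + U 0 1) / r := rfl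
  have g10 : g 1 0 = (T 1 0 + U 1 0) / r := rfl
  have g11 : g 1 1 = (T 1 1 + U 1 1) / r := rfl
  refine ⟨g, ?_⟩
  simp only [sl_ext_iff, sl_mul, g00, g01, g10, g11]
  refine ⟨?_, ?_, ?_, ?_⟩ <;> field_simp <;> grind

theorem psl_order_two [Finite F] (h2 : (2 : F) ≠ 0) (hsq : IsSquare (2 : F))
    (H : Subgroup (PSL2 F)) (hH : Nat.card H = 2) : ¬ IsPronormal H := by
  intro hp
  obtain ⟨⟨t, htH⟩, ht1, htu⟩ := (Nat.card_eq_two_iff' (1 : H)).mp hH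
  have hmem : ∀ x ∈ H, x = 1 ∨ x = t := by
    intro x hx
    by_cases h : x = 1
    · exact Or.inl h
    · right
      have := htu ⟨x, hx⟩ (by simpa [Subtype.ext_iff] using h)
      simpa using this
  have ht1' : t ≠ 1 := by simpa [Subtype.ext_iff] using ht1
  have htt : t * t = 1 := by
    rcases hmem _ (mul_mem htH htH) with h | h
    · exact h
    · exact absurd (by simpa using h) ht1'
  obtain ⟨T, rfl⟩ := QuotientGroup.mk_surjective t
  have hT := psl_lift_inv h2 T ht1' htt
  obtain ⟨U, hU, hUT⟩ := sl_exists_anti h2 T hT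
  obtain ⟨g, hg⟩ := sl_conj h2 hsq T U hT hU hUT
  have hg' : (QuotientGroup.mk g : PSL2 F) * QuotientGroup.mk U * (QuotientGroup.mk g)⁻¹
      = QuotientGroup.mk T := by
    rw [mul_inv_eq_iff_eq_mul, ← QuotientGroup.mk_mul, hg, QuotientGroup.mk_mul]
  have hcom : (QuotientGroup.mk U : PSL2 F) * QuotientGroup.mk T
      = QuotientGroup.mk T * QuotientGroup.mk U := by
    rw [← QuotientGroup.mk_mul, ← QuotientGroup.mk_mul, psl_eq]
    exact Or.inr hUT
  have hUH : (QuotientGroup.mk U : PSL2 F) ∈ H.conjugate (QuotientGroup.mk g) := by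
    rw [mem_conjugate, hg']; exact htH
  have key : H.conjugate (QuotientGroup.mk g) ≤ Subgroup.normalizer (H : Set (PSL2 F)) := by
    intro x hx
    rw [mem_conjugate] at hx
    have hxU : x = 1 ∨ x = QuotientGroup.mk U := by
      rcases hmem _ hx with h | h
      · left; simpa using h
      · right
        rw [← hg'] at h
        simpa using h
    rcases hxU with rfl | rfl
    · exact one_mem _
    · have hUc : (QuotientGroup.mk U : PSL2 F) ∈ Subgroup.centralizer (H : Set (PSL2 F)) := by
        rw [Subgroup.mem_centralizer_iff]
        intro y hy
        rcases hmem y hy with rfl | rfl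
        · simp
        · exact hcom.symm
      exact Subgroup.centralizer_le_normalizer _ hUc
  have := pron_conj_mem hp _ key
  rw [this] at hUH
  have h4 : (4 : F) ≠ 0 := by
    have : (4 : F) = 2 * 2 := by norm_num
    rw [this]; exact mul_ne_zero h2 h2
  have hne : (-1 : SL2 F) ≠ 1 := by
    intro h
    have := congrArg (fun X : SL2 F => X 0 0) h
    simp only [sl_neg, sl_one00] at this
    apply h2; linear_combination -this
  rcases hmem _ hUH with h | h
  · rcases (psl_one U).mp h with rfl | rfl
    · apply hne; rw [← hU]; simp
    · apply hne; rw [← hU]; simp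
  · rcases (psl_eq U T).mp h with rfl | rfl
    · rw [hU] at hUT; apply hne; rw [hUT]; simp
    · simp only [neg_mul, mul_neg, hT, neg_neg] at hUT
      exact hne hUT.symm

end SL

theorem stmt12 (p n q : ℕ) (hp : p.Prime) (hq : q = p ^ n) (hodd : Odd q)
    (hmod : q % 8 = 1 ∨ q % 8 = 7)
    (F : Type*) [Field F] [Fintype F] (hF : Fintype.card F = q)
    (k : ℕ)
    (hk : k = (Nat.card (Matrix.ProjectiveSpecialLinearGroup (Fin 2) F)).factorization 2)
    (j : ℕ) (hj1 : 1 ≤ j) (hjk : j ≤ k - 2)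
    (H : Subgroup (Matrix.ProjectiveSpecialLinearGroup (Fin 2) F))
    (hiso : Nonempty (H ≃* DihedralGroup (2 ^ (j - 1)))) :
    ¬ IsPronormal H := by
  have h2 : (2 : F) ≠ 0 := by
    apply Ring.two_ne_zero
    rw [Ne, FiniteField.even_card_iff_char_two]
    omega
  have hsq : IsSquare (2 : F) := by
    rw [FiniteField.isSquare_two_iff]; omega
  obtain ⟨e⟩ := hiso
  have hcard : Nat.card H = 2 ^ j := by
    rw [Nat.card_congr e.toEquiv, DihedralGroup.nat_card, ← pow_succ', Nat.sub_add_cancel hj1]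
  rcases Nat.eq_or_lt_of_le hj1 with h1 | h1
  · subst h1
    exact psl_order_two h2 hsq H (by simpa using hcard)
  intro hpro
  have : Fact (Nat.Prime 2) := ⟨Nat.prime_two⟩
  have hH : IsPGroup 2 H := IsPGroup.of_card hcard
  obtain ⟨P, hHP⟩ := hH.exists_le_sylow
  have hPN := pron_normal hpro P hHP
  have hPc : Nat.card P = 2 ^ k := by rw [hk]; exact P.card_eq_multiplicity
  have : Nontrivial P := by
    rw [← Finite.one_lt_card_iff_nontrivial, hPc]
    exact Nat.one_lt_two_pow (by omega)
  have := P.isPGroup'.center_nontrivial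
  obtain ⟨z, hz⟩ : ∃ z : Subgroup.center P, orderOf z = 2 := by
    apply exists_prime_orderOf_dvd_card'
    obtain ⟨m, hm, hm'⟩ := (P.isPGroup'.to_subgroup (Subgroup.center P)).nontrivial_iff_card.mp
      inferInstance
    rw [hm']
    exact dvd_pow_self 2 hm.ne'
  have hz1 : ((z : P) : Matrix.ProjectiveSpecialLinearGroup (Fin 2) F) ≠ 1 := by
    intro h
    have : z = 1 := by ext; exact h
    rw [this] at hz; simp at hz
  have hzz : ((z : P) : Matrix.ProjectiveSpecialLinearGroup (Fin 2) F) * (z : P) = 1 := by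
    have := pow_orderOf_eq_one z
    rw [hz, pow_two] at this
    have := congrArg (fun w : Subgroup.center P =>
      ((w : P) : Matrix.ProjectiveSpecialLinearGroup (Fin 2) F)) this
    simpa using this
  have hzP : ∀ x ∈ (P : Subgroup (Matrix.ProjectiveSpecialLinearGroup (Fin 2) F)),
      x * (z : P) = (z : P) * x := by
    intro x hx
    have := Subgroup.mem_center_iff.mp z.2 ⟨x, hx⟩
    exact congrArg Subtype.val this
  obtain ⟨s, hs, hs1, hss, hsz⟩ : ∃ s ∈ H, s ≠ 1 ∧ s * s = 1 ∧
      s ≠ ((z : P) : Matrix.ProjectiveSpecialLinearGroup (Fin 2) F) := by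
    have hsr : ∀ i, ((e.symm (DihedralGroup.sr i) : H) :
        Matrix.ProjectiveSpecialLinearGroup (Fin 2) F) ≠ 1 ∧
        ((e.symm (DihedralGroup.sr i) : H) : Matrix.ProjectiveSpecialLinearGroup (Fin 2) F) *
        (e.symm (DihedralGroup.sr i) : H) = 1 := by
      intro i
      constructor
      · intro h
        have h' : e.symm (DihedralGroup.sr i) = 1 := by ext; exact h
        rw [map_eq_one_iff _ e.symm.injective] at h'
        exact DihedralGroup.noConfusion rfl (heq_of_eq h')
      · rw [← Subgroup.coe_mul, ← map_mul]
        simp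
    by_cases h : ((e.symm (DihedralGroup.sr 0) : H) :
        Matrix.ProjectiveSpecialLinearGroup (Fin 2) F) = (z : P)
    · refine ⟨_, (e.symm (DihedralGroup.sr 1)).2, (hsr 1).1, (hsr 1).2, ?_⟩
      intro h'
      rw [← h'] at h
      have h3 := DihedralGroup.sr.inj (e.symm.injective (Subtype.ext h))
      have : Fact (1 < 2 ^ (j - 1)) := ⟨Nat.one_lt_two_pow (by omega)⟩
      exact zero_ne_one h3
    · exact ⟨_, (e.symm (DihedralGroup.sr 0)).2, (hsr 0).1, (hsr 0).2, h⟩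
  have hb := psl_bound h2 (P : Subgroup _) H (z : P) hHP hPN hz1 hzz hzP s hs hs1 hss hsz
  have hPc' : Nat.card (P : Subgroup (Matrix.ProjectiveSpecialLinearGroup (Fin 2) F)) = 2 ^ k := hPc
  rw [hPc', hcard, ← pow_succ'] at hb
  have := (Nat.pow_le_pow_iff_right (by norm_num : 1 < 2)).mp hb
  omega
end

section
/- Let q be an odd prime power with q ≡ 3 (mod 8) or q ≡ 5 (mod 8), and let G = PSL(2, F_q). Then every subgroup of G of order 2 is not pronormal in G, while every Sylow 2-subgroup of G (which has order 4 and is isomorphic to the Klein four-group) is pronormal in G. -/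
open scoped Pointwise in
lemma conjugate_eq_smul {G : Type*} [Group G] (H : Subgroup G) (g : G) :
    H.conjugate g = MulAut.conj g⁻¹ • H := rfl

open scoped Pointwise in
lemma sylow_pronormal {G : Type*} [Group G] [Finite G] (S : Sylow 2 G) :
    IsPronormal (S : Subgroup G) := by
  intro g
  set K : Subgroup G := (S : Subgroup G) ⊔ (S : Subgroup G).conjugate g with hK
  have h1 : (S : Subgroup G) ≤ K := le_sup_left
  have h2 : ((g⁻¹ • S : Sylow 2 G) : Subgroup G) ≤ K := by
    rw [Sylow.coe_subgroup_smul]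
    exact le_sup_right
  obtain ⟨x, hx⟩ := MulAction.exists_smul_eq K (S.subtype h1) ((g⁻¹ • S).subtype h2)
  rw [Sylow.smul_subtype] at hx
  have h3 := Sylow.subtype_injective hx
  refine ⟨(x : G)⁻¹, K.inv_mem x.2, ?_⟩
  have h4 := congrArg (fun P : Sylow 2 G => (P : Subgroup G)) h3
  simp only [Sylow.coe_subgroup_smul] at h4
  rw [conjugate_eq_smul, conjugate_eq_smul, inv_inv]
  exact h4

/-- If an involution commutes with a different conjugate of itself, then the subgroup of order two
it generates is not pronormal. -/
lemma not_pronormal_of {G : Type*} [Group G] (H : Subgroup G) (t g : G)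
    (hH : ∀ h, h ∈ H ↔ h = 1 ∨ h = t) (ht : t ≠ 1)
    (hc : Commute t (g⁻¹ * t * g)) (hne : g⁻¹ * t * g ≠ t) : ¬ IsPronormal H := by
  intro hpro
  obtain ⟨x, hx, he⟩ := hpro g
  have hle : H ⊔ H.conjugate g ≤ Subgroup.centralizer {t} := by
    refine sup_le ?_ ?_
    · intro h hh
      rw [Subgroup.mem_centralizer_singleton_iff]
      rcases (hH h).1 hh with rfl | rfl <;> simp
    · rintro _ ⟨h, hh, rfl⟩
      rw [Subgroup.mem_centralizer_singleton_iff]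
      rcases (hH h).1 hh with rfl | rfl
      · simp
      · simpa using hc.eq.symm
  have hxc := hle hx
  rw [Subgroup.mem_centralizer_singleton_iff] at hxc
  have hm : g⁻¹ * t * g ∈ H.conjugate x := by
    rw [he]
    exact ⟨t, (hH t).2 (Or.inr rfl), by simp⟩
  obtain ⟨h, hh, hhe⟩ := hm
  rcases (hH h).1 hh with rfl | rfl
  · have h5 : 1 = g⁻¹ * t * g := by simpa using hhe
    apply ht
    have h6 : t = g * (g⁻¹ * t * g) * g⁻¹ := by group
    rw [h6, ← h5]; simp
  · apply hne
    have h5 : x⁻¹ * h * x = g⁻¹ * h * g := by simpa using hhe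
    rw [← h5, mul_assoc, ← hxc]; simp

open Matrix in
lemma exists_anti {F : Type*} [Field F] [Finite F] (h2 : (2 : F) ≠ 0) (a b c : F)
    (h : -a * a - b * c = 1) :
    ∃ x y z : F, 2 * a * x + b * z + c * y = 0 ∧ -x * x - y * z = 1 := by
  by_cases hb : b = 0
  · subst hb
    have ha : a ≠ 0 := by rintro rfl; simp at h
    refine ⟨-c / (2 * a), 1, -1 - (-c / (2 * a)) ^ 2, ?_, ?_⟩
    · field_simp; ring
    · ring
  · have : Fact (ringChar F).Prime := ⟨CharP.char_is_prime F _⟩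
    obtain ⟨s, t, hst⟩ := CharP.sq_add_sq F (ringChar F) (-1)
    generalize (s : F) = s at hst
    generalize (t : F) = t at hst
    push_cast at hst
    refine ⟨s + a * t, b * t, -(2 * a * (s + a * t) + c * (b * t)) / b, ?_, ?_⟩
    · field_simp; ring
    · field_simp
      linear_combination (-1) * hst - t ^ 2 * h

open Matrix in
lemma exists_conj {F : Type*} [Field F] [Finite F] (h2 : (2 : F) ≠ 0)
    (A : SpecialLinearGroup (Fin 2) F) (hA : A 1 1 = - A 0 0) :
    ∃ g B : SpecialLinearGroup (Fin 2) F, A * g = g * B ∧ A * B = - (B * A) := by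
  have hdet := A.2
  rw [det_fin_two] at hdet
  change A 0 0 * A 1 1 - A 0 1 * A 1 0 = 1 at hdet
  have hAe : A.1 = !![A 0 0, A 0 1; A 1 0, - A 0 0] := by
    rw [← hA]; exact eta_fin_two A.1
  rw [hA] at hdet
  generalize A 0 0 = a at *
  generalize A 0 1 = b at *
  generalize A 1 0 = c at *
  obtain ⟨x, y, z, h1, h3⟩ := exists_anti h2 a b c (by linear_combination hdet)
  refine ⟨⟨!![(a + x - 1 + (a * x + b * z)) / 2, (b + y + (a * y - b * x)) / 2;
      (c + z + (c * x - a * z)) / 2, (-a - x - 1 + (c * y + a * x)) / 2], ?_⟩,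
      ⟨!![x, y; z, -x], ?_⟩, ?_, ?_⟩
  · rw [det_fin_two_of]
    have h4 : (2 : F) * 2⁻¹ = 1 := mul_inv_cancel₀ h2
    simp only [div_eq_mul_inv]
    generalize (2 : F)⁻¹ = k at *
    grind
  · rw [det_fin_two_of]; linear_combination h3
  · apply Subtype.ext
    change A.1 * !![_, _; _, _] = !![_, _; _, _] * !![_, _; _, _]
    rw [hAe, mul_fin_two, mul_fin_two]
    ext i j
    fin_cases i <;> fin_cases j <;> simp <;> field_simp
    all_goals grind
  · apply Subtype.ext
    change A.1 * !![_, _; _, _] = - (!![_, _; _, _] * A.1)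
    rw [hAe, mul_fin_two, mul_fin_two]
    ext i j
    fin_cases i <;> fin_cases j <;> simp
    · linear_combination h1
    · ring
    · ring
    · linear_combination h1

theorem stmt14 (p n q : ℕ) (hp : p.Prime) (hq : q = p ^ n) (hodd : Odd q)
    (hmod : q % 8 = 3 ∨ q % 8 = 5)
    (F : Type*) [Field F] [Fintype F] (hF : Fintype.card F = q) :
    (∀ H : Subgroup (Matrix.ProjectiveSpecialLinearGroup (Fin 2) F),
      Nat.card H = 2 → ¬ IsPronormal H) ∧
    (∀ S : Sylow 2 (Matrix.ProjectiveSpecialLinearGroup (Fin 2) F),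
      IsPronormal (S : Subgroup (Matrix.ProjectiveSpecialLinearGroup (Fin 2) F))) := by
  have h2 : (2 : F) ≠ 0 := by
    apply Ring.two_ne_zero
    intro hc
    have := FiniteField.even_card_of_char_two hc
    rw [hF] at this
    have := Nat.odd_iff.1 hodd
    omega
  refine ⟨?_, fun S => sylow_pronormal S⟩
  intro H hH
  have hfin : Finite H := Nat.finite_of_card_ne_zero (by omega)
  obtain ⟨t', ht', hu⟩ := (Nat.card_eq_two_iff' (1 : H)).1 hH
  obtain ⟨t, ht⟩ := t'
  have ht1 : t ≠ 1 := fun h => ht' (Subtype.ext h)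
  have hmem : ∀ h, h ∈ H ↔ h = 1 ∨ h = t := by
    intro h
    constructor
    · intro hh
      by_cases h1 : h = 1
      · exact Or.inl h1
      · right
        exact congrArg Subtype.val (hu ⟨h, hh⟩ (fun h' => h1 (congrArg Subtype.val h')))
    · rintro (rfl | rfl)
      · exact H.one_mem
      · exact ht
  have htt : t * t = 1 := by
    rcases (hmem _).1 (H.mul_mem ht ht) with h | h
    · exact h
    · exact absurd (by simpa using h) ht1
  clear hu ht'
  obtain ⟨A, rfl⟩ := QuotientGroup.mk_surjective t
  have hAA : A * A ∈ Subgroup.center (Matrix.SpecialLinearGroup (Fin 2) F) :=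
    (QuotientGroup.eq_one_iff _).1 htt
  have hAn : A ∉ Subgroup.center (Matrix.SpecialLinearGroup (Fin 2) F) :=
    fun h => ht1 ((QuotientGroup.eq_one_iff _).2 h)
  have htr : A 1 1 = - A 0 0 := by
    by_contra hcon
    have hs : A 1 1 + A 0 0 ≠ 0 := fun h => hcon (eq_neg_of_add_eq_zero_left h)
    rw [Matrix.SpecialLinearGroup.mem_center_iff] at hAA hAn
    obtain ⟨r, -, hr⟩ := hAA
    have e00 := congrFun (congrFun hr 0) 0
    have e01 := congrFun (congrFun hr 0) 1
    have e10 := congrFun (congrFun hr 1) 0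
    have e11 := congrFun (congrFun hr 1) 1
    simp [Matrix.mul_apply, Fin.sum_univ_two] at e00 e01 e10 e11
    have f01 : A 0 1 = 0 := by
      apply (mul_eq_zero.1 (?_ : (A 1 1 + A 0 0) * A 0 1 = 0)).resolve_left hs
      linear_combination -e01
    have f10 : A 1 0 = 0 := by
      apply (mul_eq_zero.1 (?_ : (A 1 1 + A 0 0) * A 1 0 = 0)).resolve_left hs
      linear_combination -e10
    have f11 : A 1 1 - A 0 0 = 0 := by
      apply (mul_eq_zero.1 (?_ : (A 1 1 + A 0 0) * (A 1 1 - A 0 0) = 0)).resolve_left hs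
      linear_combination e00 - e11
    have hdet := A.2
    rw [Matrix.det_fin_two] at hdet
    change A 0 0 * A 1 1 - A 0 1 * A 1 0 = 1 at hdet
    apply hAn
    refine ⟨A 0 0, ?_, ?_⟩
    · simp only [Fintype.card_fin]
      linear_combination hdet - A 0 0 * f11 + A 0 1 * f10
    · ext i j
      fin_cases i <;> fin_cases j <;> simp [f01, f10]
      exact (sub_eq_zero.1 f11).symm
  obtain ⟨g, B, hg, hAB⟩ := exists_conj h2 A htr
  have hB : g⁻¹ * A * g = B := by rw [mul_assoc, hg]; simp
  have hneg : ∀ M : Matrix.SpecialLinearGroup (Fin 2) F, M ≠ -M := by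
    intro M hM
    have h0 : ∀ i j, M i j = 0 := by
      intro i j
      have : M i j = - M i j := by
        conv_lhs => rw [hM]
        rfl
      have h3 : 2 * M i j = 0 := by linear_combination this
      exact (mul_eq_zero.1 h3).resolve_left h2
    have hdet := M.2
    rw [Matrix.det_fin_two] at hdet
    change M 0 0 * M 1 1 - M 0 1 * M 1 0 = 1 at hdet
    simp [h0] at hdet
  have hBq : (g : Matrix.ProjectiveSpecialLinearGroup (Fin 2) F)⁻¹ * A * g = B := by
    rw [← hB]; rfl
  refine not_pronormal_of H _ (g : Matrix.ProjectiveSpecialLinearGroup (Fin 2) F) hmem ht1 ?_ ?_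
  · rw [hBq]
    refine QuotientGroup.eq.2 (?_ : (A * B)⁻¹ * (B * A) ∈ Subgroup.center _)
    rw [hAB, Subgroup.mem_center_iff]
    intro k
    have : (-(B * A))⁻¹ * (B * A) = -1 := by
      rw [inv_mul_eq_iff_eq_mul]; simp
    rw [this]; simp
  · rw [hBq]
    intro he
    have h5 : B⁻¹ * A ∈ Subgroup.center (Matrix.SpecialLinearGroup (Fin 2) F) :=
      QuotientGroup.eq.1 he
    rw [Subgroup.mem_center_iff] at h5
    have h6 := h5 B
    have h7 : A * B = B * A := by
      have := congrArg (B * ·) h6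
      simpa [mul_assoc] using this.symm
    rw [h7] at hAB
    exact hneg _ hAB
end
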